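/- arXiv:2007.12690 — 3 statements merged into one kernel-verified Lean document; each statement's English description precedes it below -/
import Mathlib

section
/- For every real number c with 0 < c < 1, there exists an integer n_c such that for all n > n_c, there are at least c^n · n! patterns π of length n for which there exists a pattern π′ of length n with π′ ≠ π and π′ not equal to the complement of π such that π and π′ are c-forest-Wilf equivalent. -/
/-- A rooted labeled forest on `[n]`: vertices are identified with their labels in `Fin n`
(`i : Fin n` representing the label `i+1`), each vertex has an optional parent, and the
parent relation is acyclic. Components are rooted at the vertices with no parent, and
children are unordered since only the parent function is recorded. -/
structure RForest (n : ℕ) where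
  parent : Fin n → Option (Fin n)
  acyclic : ∀ v : Fin n, ¬ Relation.TransGen (fun a b => parent b = some a) v v

namespace RForest

variable {n : ℕ}

/-- `u` is a strict ancestor of `v`. -/
def SAnc (F : RForest n) (u v : Fin n) : Prop :=
  Relation.TransGen (fun a b => F.parent b = some a) u v

/-- `u` is an ancestor of `v` (possibly `u = v`). -/
def Anc (F : RForest n) (u v : Fin n) : Prop :=
  F.SAnc u v ∨ u = v

/-- `F` is a tree: it has exactly one root, i.e. exactly one component. -/
def IsTree (F : RForest n) : Prop :=
  ∃! r : Fin n, F.parent r = none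

end RForest

/-- A pattern of length `k` is a permutation of `[k]` (presented 0-indexed on `Fin k`). -/
abbrev Pattern (k : ℕ) := Equiv.Perm (Fin k)

/-- The complement of a pattern: `π̄(i) = k + 1 - π(i)` in 1-indexed terms. -/
def Pattern.compl {k : ℕ} (π : Pattern k) : Pattern k :=
  π.trans ⟨Fin.rev, Fin.rev, Fin.rev_rev, Fin.rev_rev⟩

/-- `F` contains a (classical) instance of the pattern `π`: vertices `v 0, …, v (k-1)`,
each a strict ancestor of the next, whose labels are in the same relative order as `π`. -/
def ContainsPat {n k : ℕ} (F : RForest n) (π : Pattern k) : Prop :=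
  ∃ v : Fin k → Fin n,
    (∀ i j : Fin k, i < j → F.SAnc (v i) (v j)) ∧
    (∀ i j : Fin k, v i < v j ↔ π i < π j)

/-- `v` is a consecutive instance of `π` in `F`: a downward path (each vertex the parent of
the next) whose labels are in the same relative order as `π`. -/
def IsConsInstance {n k : ℕ} (F : RForest n) (π : Pattern k) (v : Fin k → Fin n) : Prop :=
  (∀ i j : Fin k, (j : ℕ) = (i : ℕ) + 1 → F.parent (v j) = some (v i)) ∧
  (∀ i j : Fin k, v i < v j ↔ π i < π j)

/-- `F` contains a consecutive instance of `π`. -/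
def CContainsPat {n k : ℕ} (F : RForest n) (π : Pattern k) : Prop :=
  ∃ v, IsConsInstance F π v

/-- `F` avoids every pattern in the set `S` (of patterns of arbitrary lengths). -/
def AvoidsSet {n : ℕ} (F : RForest n) (S : Set ((k : ℕ) × Pattern k)) : Prop :=
  ∀ p ∈ S, ¬ ContainsPat F p.2

/-- `f_n(S)`: the number of rooted labeled forests on `[n]` avoiding `S`. -/
noncomputable def fCount (S : Set ((k : ℕ) × Pattern k)) (n : ℕ) : ℕ :=
  Nat.card {F : RForest n // AvoidsSet F S}

/-- `t_n(S)`: the number of rooted labeled trees on `[n]` avoiding `S`. -/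
noncomputable def tCount (S : Set ((k : ℕ) × Pattern k)) (n : ℕ) : ℕ :=
  Nat.card {F : RForest n // F.IsTree ∧ AvoidsSet F S}

/-- The number of rooted labeled forests on `[n]` consecutively avoiding `π`. -/
noncomputable def cCount {k : ℕ} (π : Pattern k) (n : ℕ) : ℕ :=
  Nat.card {F : RForest n // ¬ CContainsPat F π}

/-- c-forest-Wilf equivalence of two patterns. -/
def CForestWilfEquiv {k k' : ℕ} (π : Pattern k) (π' : Pattern k') : Prop :=
  ∀ n : ℕ, cCount π n = cCount π' n

def p123 : Pattern 3 := 1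
def p132 : Pattern 3 := ⟨![0, 2, 1], ![0, 2, 1], by intro x; fin_cases x <;> rfl, by intro x; fin_cases x <;> rfl⟩
def p213 : Pattern 3 := ⟨![1, 0, 2], ![1, 0, 2], by intro x; fin_cases x <;> rfl, by intro x; fin_cases x <;> rfl⟩
def p231 : Pattern 3 := ⟨![1, 2, 0], ![2, 0, 1], by intro x; fin_cases x <;> rfl, by intro x; fin_cases x <;> rfl⟩
def p312 : Pattern 3 := ⟨![2, 0, 1], ![1, 2, 0], by intro x; fin_cases x <;> rfl, by intro x; fin_cases x <;> rfl⟩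
def p321 : Pattern 3 := ⟨![2, 1, 0], ![2, 1, 0], by intro x; fin_cases x <;> rfl, by intro x; fin_cases x <;> rfl⟩
def p2413 : Pattern 4 := ⟨![1, 3, 0, 2], ![2, 0, 3, 1], by intro x; fin_cases x <;> rfl, by intro x; fin_cases x <;> rfl⟩
def p2314 : Pattern 4 := ⟨![1, 2, 0, 3], ![2, 0, 1, 3], by intro x; fin_cases x <;> rfl, by intro x; fin_cases x <;> rfl⟩
def p3142 : Pattern 4 := ⟨![2, 0, 3, 1], ![1, 3, 0, 2], by intro x; fin_cases x <;> rfl, by intro x; fin_cases x <;> rfl⟩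
def p3124 : Pattern 4 := ⟨![2, 0, 1, 3], ![1, 2, 0, 3], by intro x; fin_cases x <;> rfl, by intro x; fin_cases x <;> rfl⟩

/-- The numerical shape, on `T + 6` positions, of the patterns considered here: the sequence is
`0, 7, *, …, *, 2, 5, 3, 1, 6, 4` with every `*` at least `8`. -/
structure SwapShape (T : ℕ) (e : ℕ → ℕ) : Prop where
  four_le : 4 ≤ T
  at_zero : e 0 = 0
  at_one : e 1 = 7
  eight_le : ∀ i, 2 ≤ i → i < T → 8 ≤ e i
  at_T0 : e T = 2
  at_T1 : e (T + 1) = 5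
  at_T2 : e (T + 2) = 3
  at_T3 : e (T + 3) = 1
  at_T4 : e (T + 4) = 6
  at_T5 : e (T + 5) = 4

/-- The two positions `T + 2` and `T + 5` whose values get exchanged. -/
def SwapPos (T i : ℕ) : Prop := i = T + 2 ∨ i = T + 5

theorem SwapShape.gap {T : ℕ} {e : ℕ → ℕ} (he : SwapShape T e) {j : ℕ} (hj : j < T + 6)
    (hs : ¬ SwapPos T j) : e j ≤ 2 ∨ 5 ≤ e j := by
  obtain ⟨h4, h0, h1, h8, a0, a1, a2, a3, a4, a5⟩ := he
  unfold SwapPos at hs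
  by_cases hj0 : j = 0
  · subst hj0; omega
  by_cases hj1 : j = 1
  · subst hj1; omega
  by_cases hjT : j < T
  · have := h8 j (by omega) hjT; omega
  have : j = T ∨ j = T + 1 ∨ j = T + 3 ∨ j = T + 4 := by omega
  rcases this with rfl | rfl | rfl | rfl <;> omega

theorem SwapShape.pos_of_ne {T : ℕ} {e : ℕ → ℕ} (he : SwapShape T e) {j : ℕ} (h0 : 1 ≤ j)
    (hj : j < T + 6) : 0 < e j := by
  obtain ⟨h4, -, h1, h8, a0, a1, a2, a3, a4, a5⟩ := he
  by_cases hj1 : j = 1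
  · subst hj1; omega
  by_cases hjT : j < T
  · have := h8 j (by omega) hjT; omega
  have : j = T ∨ j = T + 1 ∨ j = T + 2 ∨ j = T + 3 ∨ j = T + 4 ∨ j = T + 5 := by omega
  rcases this with rfl | rfl | rfl | rfl | rfl | rfl <;> omega

theorem SwapShape.large {T : ℕ} {e : ℕ → ℕ} (he : SwapShape T e) {j : ℕ} (h0 : 1 ≤ j)
    (hj : j < T) : 7 ≤ e j := by
  by_cases hj1 : j = 1
  · subst hj1; exact he.at_one.ge
  · have := he.eight_le j (by omega) hj; omega

/-- The first `m` entries of `s` form a downward path for the parent function `par`, in the same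
relative order as the first `m` entries of `e`, except that the entries at the two swap positions
are not compared with each other. -/
def PartInst {α : Type*} [LinearOrder α] (T : ℕ) (e : ℕ → ℕ) (par : α → Option α) (m : ℕ)
    (s : ℕ → α) : Prop :=
  (∀ i, i + 1 < m → par (s (i + 1)) = some (s i)) ∧
  ∀ i j, i < m → j < m → ¬ (i = T + 2 ∧ j = T + 5) → ¬ (i = T + 5 ∧ j = T + 2) →
    (s i < s j ↔ e i < e j)

/-- `w` occupies a swap position in a partial instance whose entry at `T + 1` is `u`. -/
def InGroup {α : Type*} [LinearOrder α] (T : ℕ) (e : ℕ → ℕ) (par : α → Option α) (u w : α) :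
    Prop :=
  ∃ s i, SwapPos T i ∧ PartInst T e par (i + 1) s ∧ s (T + 1) = u ∧ s i = w

theorem Finset.exists_reversal {α : Type*} [LinearOrder α] (S : Finset α) :
    ∃ r : α → α, (∀ w, w ∉ S → r w = w) ∧ (∀ w ∈ S, r w ∈ S) ∧ (∀ w ∈ S, r (r w) = w) ∧
      ∀ w ∈ S, ∀ z ∈ S, w < z → r z < r w := by
  classical
  let f := S.orderIsoOfFin rfl
  refine ⟨fun w => if h : w ∈ S then (f (Fin.rev (f.symm ⟨w, h⟩)) : α) else w, ?_, ?_, ?_, ?_⟩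
  · intro w hw; simp [hw]
  · intro w hw; simp [hw]
  · intro w hw; simp [hw]
  · intro w hw z hz hwz
    simp only [hw, hz, dite_true]
    have : f.symm ⟨w, hw⟩ < f.symm ⟨z, hz⟩ := f.symm.lt_iff_lt.2 hwz
    exact f.lt_iff_lt.2 (Fin.rev_lt_rev.2 this)

/-- The order-reversing involution of a finset, extended by the identity. -/
noncomputable def Finset.reversal {α : Type*} [LinearOrder α] (S : Finset α) : α → α :=
  (Finset.exists_reversal S).choose

section

variable {α : Type*} [LinearOrder α] {T : ℕ} {e : ℕ → ℕ} {par : α → Option α}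

theorem PartInst.mono {m m' : ℕ} {s : ℕ → α} (h : PartInst T e par m s) (hm : m' ≤ m) :
    PartInst T e par m' s :=
  ⟨fun i hi => h.1 i (by omega), fun i j hi hj => h.2 i j (by omega) (by omega)⟩

theorem PartInst.common_ancestors {i j : ℕ} {s s' : ℕ → α} (h : PartInst T e par (i + 1) s)
    (h' : PartInst T e par (j + 1) s') (hij : s i = s' j) (t : ℕ) (hi : t ≤ i) (hj : t ≤ j) :
    s (i - t) = s' (j - t) := by
  induction t with
  | zero => simpa using hij
  | succ t ih =>
    have ih := ih (by omega) (by omega)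
    have h1 := h.1 (i - (t + 1)) (by omega)
    have h2 := h'.1 (j - (t + 1)) (by omega)
    rw [show i - (t + 1) + 1 = i - t by omega] at h1
    rw [show j - (t + 1) + 1 = j - t by omega, ← ih, h1] at h2
    exact Option.some_injective _ h2

/-- A vertex at a swap position of a partial instance can only be the start of any other partial
instance with a different start. -/
theorem PartInst.overlap (he : SwapShape T e) {i j : ℕ} {s s' : ℕ → α} (hi : SwapPos T i)
    (hj1 : 1 ≤ j) (hj : j < T + 6) (h : PartInst T e par (i + 1) s)
    (h' : PartInst T e par (j + 1) s') (hij : s i = s' j) :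
    i = j ∧ ∀ t ≤ i, s t = s' t := by
  have key := h.common_ancestors h' hij
  have h4 := he.four_le
  have hi' : i = T + 2 ∨ i = T + 5 := hi
  rcases lt_trichotomy i j with hlt | rfl | hgt
  · exfalso
    obtain ⟨d, rfl⟩ : ∃ d, j = i + d := ⟨j - i, by omega⟩
    have k1 := key i le_rfl (by omega)
    have k2 := key (i - (T - d)) (by omega) (by omega)
    rw [show i - i = 0 by omega, show i + d - i = d by omega] at k1
    rw [show i - (i - (T - d)) = T - d by omega,
      show i + d - (i - (T - d)) = T by omega] at k2
    have o1 : s 0 < s (T - d) := (h.2 0 (T - d) (by omega) (by omega) (by omega) (by omega)).2 (by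
      rw [he.at_zero]; exact he.pos_of_ne (by omega) (by omega))
    have o2 : s' T < s' d := (h'.2 T d (by omega) (by omega) (by omega) (by omega)).2 (by
      rw [he.at_T0]; have := he.large (j := d) (by omega) (by omega); omega)
    rw [k1, k2] at o1
    exact lt_asymm o1 o2
  · refine ⟨rfl, fun t ht => ?_⟩
    have := key (i - t) (by omega) (by omega)
    rwa [show i - (i - t) = t by omega] at this
  · exfalso
    obtain ⟨d, rfl⟩ : ∃ d, i = j + d := ⟨i - j, by omega⟩
    have k : ∀ t ≤ j, s (t + d) = s' t := fun t ht => by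
      have := key (j - t) (by omega) (by omega)
      rwa [show j - (j - t) = t by omega, show j + d - (j - t) = t + d by omega] at this
    have start : ∀ t, 1 ≤ t → t ≤ j → ¬ (d = T + 2 ∧ t = 3) → s d < s (t + d) := by
      intro t ht htj hne
      have := k 0 (by omega)
      rw [zero_add] at this
      rw [this, k t htj, h'.2 0 t (by omega) (by omega) (by omega) (by omega), he.at_zero]
      exact he.pos_of_ne ht (by omega)
    have second : 2 ≤ j → s (1 + d) < s (2 + d) := by
      intro h2
      rw [k 1 (by omega), k 2 h2, h'.2 1 2 (by omega) (by omega) (by omega) (by omega), he.at_one]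
      have := he.eight_le 2 le_rfl (by omega); omega
    rcases lt_or_ge d T with hd | hd
    · have := start (T - d) (by omega) (by omega) (by omega)
      rw [h.2 _ _ (by omega) (by omega) (by omega) (by omega),
        show T - d + d = T by omega, he.at_T0] at this
      have := he.large (j := d) (by omega) hd
      omega
    obtain rfl | rfl | rfl | rfl | rfl :
        d = T ∨ d = T + 1 ∨ d = T + 2 ∨ d = T + 3 ∨ d = T + 4 := by omega
    · have := second (by omega)
      rw [h.2 _ _ (by omega) (by omega) (by omega) (by omega), add_comm 1, add_comm 2, he.at_T1,
        he.at_T2] at this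
      omega
    · have := start 1 (by omega) (by omega) (by omega)
      rw [h.2 _ _ (by omega) (by omega) (by omega) (by omega),
        show 1 + (T + 1) = T + 2 by omega, he.at_T1, he.at_T2] at this
      omega
    · have := start 1 (by omega) (by omega) (by omega)
      rw [h.2 _ _ (by omega) (by omega) (by omega) (by omega),
        show 1 + (T + 2) = T + 3 by omega, he.at_T2, he.at_T3] at this
      omega
    · have := second (by omega)
      rw [h.2 _ _ (by omega) (by omega) (by omega) (by omega),
        show 1 + (T + 3) = T + 4 by omega, show 2 + (T + 3) = T + 5 by omega, he.at_T4,
        he.at_T5] at this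
      omega
    · have := start 1 (by omega) (by omega) (by omega)
      rw [h.2 _ _ (by omega) (by omega) (by omega) (by omega),
        show 1 + (T + 4) = T + 5 by omega, he.at_T4, he.at_T5] at this
      omega

theorem InGroup.unique (he : SwapShape T e) {u u' w : α} (h : InGroup T e par u w)
    (h' : InGroup T e par u' w) : u = u' := by
  obtain ⟨s, i, hi, hs, rfl, rfl⟩ := h
  obtain ⟨s', i', hi', hs', rfl, hw⟩ := h'
  unfold SwapPos at hi'
  have := (hs.overlap he hi (by omega) (by omega) hs' hw.symm).2 (T + 1)
    (by unfold SwapPos at hi; omega)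
  exact this

theorem PartInst.not_inGroup (he : SwapShape T e) {j m : ℕ} {s : ℕ → α}
    (h : PartInst T e par m s) (hjm : j < m) (hj1 : 1 ≤ j) (hj : j < T + 6)
    (hs : ¬ SwapPos T j) (u : α) : ¬ InGroup T e par u (s j) := by
  rintro ⟨s', i, hi, hs', -, hw⟩
  obtain ⟨rfl, -⟩ := hs'.overlap he hi hj1 hj (h.mono hjm) hw
  exact hs hi

theorem PartInst.swapPos_bounds (he : SwapShape T e) {i m : ℕ} {s : ℕ → α}
    (h : PartInst T e par m s) (him : i < m) (hi : SwapPos T i) :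
    s T < s i ∧ s i < s (T + 1) := by
  have hi' : i = T + 2 ∨ i = T + 5 := hi
  rw [h.2 _ _ (by omega) (by omega) (by omega) (by omega),
    h.2 _ _ (by omega) (by omega) (by omega) (by omega), he.at_T0, he.at_T1]
  rcases hi' with rfl | rfl
  · rw [he.at_T2]; omega
  · rw [he.at_T5]; omega

theorem PartInst.inGroup {i m : ℕ} {s : ℕ → α} (h : PartInst T e par m s) (him : i < m)
    (hi : SwapPos T i) : InGroup T e par (s (T + 1)) (s i) :=
  ⟨s, i, hi, h.mono him, rfl, rfl⟩

theorem InGroup.bounds (he : SwapShape T e) {u L w : α} (h : InGroup T e par u w)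
    (hL : par u = some L) : L < w ∧ w < u := by
  obtain ⟨s, i, hi, hs, rfl, rfl⟩ := h
  have := hs.1 T (by unfold SwapPos at hi; omega)
  rw [hL] at this
  obtain rfl := Option.some_injective _ this
  exact hs.swapPos_bounds he (by omega) hi

/-- The parent of a vertex in a group lies in no group. -/
theorem InGroup.parent_not_inGroup (he : SwapShape T e) {u w z : α} (h : InGroup T e par u w)
    (hz : par w = some z) (u' : α) : ¬ InGroup T e par u' z := by
  obtain ⟨s, i, hi, hs, -, rfl⟩ := h
  have hi' : i = T + 2 ∨ i = T + 5 := hi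
  obtain ⟨i, rfl⟩ : ∃ i', i = i' + 1 := ⟨i - 1, by omega⟩
  rw [hs.1 i (by omega)] at hz
  obtain rfl := Option.some_injective _ hz
  exact hs.not_inGroup he (by omega) (by omega) (by omega) (by unfold SwapPos; omega) u'

theorem PartInst.transGen {i m : ℕ} {s : ℕ → α} (h : PartInst T e par m s) (j : ℕ) (hij : i < j)
    (hj : j < m) : Relation.TransGen (fun a b => par b = some a) (s i) (s j) := by
  induction j, hij using Nat.le_induction with
  | base => exact .single (h.1 i hj)
  | succ j hij ih => exact (ih (by omega)).tail (h.1 j hj)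

variable [Fintype α]

variable (T e par) in
open Classical in
/-- All vertices lying in a common group with `w`. -/
noncomputable def groupOf (w : α) : Finset α :=
  Finset.univ.filter fun z => ∃ u, InGroup T e par u w ∧ InGroup T e par u z

variable (T e par) in
/-- The involution reversing the order of the labels inside each group. -/
noncomputable def groupRev (w : α) : α := (groupOf T e par w).reversal w

theorem mem_groupOf {w z : α} :
    z ∈ groupOf T e par w ↔ ∃ u, InGroup T e par u w ∧ InGroup T e par u z := by
  simp [groupOf]

theorem groupOf_congr (he : SwapShape T e) {u w z : α} (hw : InGroup T e par u w)
    (hz : InGroup T e par u z) : groupOf T e par w = groupOf T e par z := by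
  ext x
  rw [mem_groupOf, mem_groupOf]
  constructor
  · rintro ⟨u', h1, h2⟩; obtain rfl := hw.unique he h1; exact ⟨_, hz, h2⟩
  · rintro ⟨u', h1, h2⟩; obtain rfl := hz.unique he h1; exact ⟨_, hw, h2⟩

theorem groupRev_of_not_inGroup {w : α} (h : ∀ u, ¬ InGroup T e par u w) :
    groupRev T e par w = w :=
  (Finset.exists_reversal _).choose_spec.1 w (by rw [mem_groupOf]; rintro ⟨u, hu, -⟩; exact h u hu)

theorem InGroup.groupRev (he : SwapShape T e) {u w : α} (h : InGroup T e par u w) :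
    InGroup T e par u (groupRev T e par w) := by
  have := (Finset.exists_reversal (groupOf T e par w)).choose_spec.2.1 w
    (mem_groupOf.2 ⟨u, h, h⟩)
  obtain ⟨u', h1, h2⟩ := mem_groupOf.1 this
  obtain rfl := h.unique he h1
  exact h2

theorem groupRev_groupRev (he : SwapShape T e) (w : α) :
    groupRev T e par (groupRev T e par w) = w := by
  by_cases h : ∃ u, InGroup T e par u w
  · obtain ⟨u, h⟩ := h
    have := (Finset.exists_reversal (groupOf T e par w)).choose_spec.2.2.1 w
      (mem_groupOf.2 ⟨u, h, h⟩)
    have h2 := groupOf_congr he (h.groupRev he) h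
    rw [_root_.groupRev, h2]
    exact this
  · push Not at h
    rw [groupRev_of_not_inGroup h, groupRev_of_not_inGroup h]

theorem groupRev_lt (he : SwapShape T e) {u w z : α} (hw : InGroup T e par u w)
    (hz : InGroup T e par u z) (hwz : w < z) : groupRev T e par z < groupRev T e par w := by
  rw [groupRev, groupRev, groupOf_congr he hz hw]
  exact (Finset.exists_reversal (groupOf T e par w)).choose_spec.2.2.2 w
    (mem_groupOf.2 ⟨u, hw, hw⟩) z (mem_groupOf.2 ⟨u, hw, hz⟩) hwz

variable (T e par) in
/-- Apply `groupRev` at the swap positions. -/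
noncomputable def twist (s : ℕ → α) (i : ℕ) : α :=
  open Classical in if SwapPos T i then groupRev T e par (s i) else s i

variable (T e par) in
/-- The modified parent function: the labels in each group are reversed, each label carrying its
children along, except for the children smaller than both labels involved, which stay in place. -/
noncomputable def newPar (w : α) : Option α :=
  (par (groupRev T e par w)).map fun z =>
    if w < z ∧ w < groupRev T e par z then groupRev T e par z else z

theorem twist_swapPos {s : ℕ → α} {i : ℕ} (hi : SwapPos T i) :
    twist T e par s i = groupRev T e par (s i) := if_pos hi

theorem twist_not_swapPos {s : ℕ → α} {i : ℕ} (hi : ¬ SwapPos T i) :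
    twist T e par s i = s i := if_neg hi

theorem twist_order (he : SwapShape T e) {q : α → Option α} {m : ℕ} (hm : m ≤ T + 6)
    {s : ℕ → α} (h : PartInst T e q m s)
    (hb : ∀ i < m, SwapPos T i →
      s T < groupRev T e par (s i) ∧ groupRev T e par (s i) < s (T + 1))
    (i j : ℕ) (hi : i < m) (hj : j < m) (h1 : ¬ (i = T + 2 ∧ j = T + 5))
    (h2 : ¬ (i = T + 5 ∧ j = T + 2)) :
    twist T e par s i < twist T e par s j ↔ e i < e j := by
  have val : ∀ i, SwapPos T i → 3 ≤ e i ∧ e i ≤ 4 ∧ T + 2 ≤ i := by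
    rintro i (rfl | rfl)
    · rw [he.at_T2]; omega
    · rw [he.at_T5]; omega
  by_cases si : SwapPos T i <;> by_cases sj : SwapPos T j
  · have : i = j := by unfold SwapPos at si sj; omega
    subst this; simp
  · rw [twist_swapPos si, twist_not_swapPos sj]
    obtain ⟨b1, b2⟩ := hb i hi si
    have vi := val i si
    rcases he.gap (by omega) sj with g | g
    · have : ¬ s T < s j := by
        rw [h.2 _ _ (by omega) hj (by omega) (by omega), he.at_T0]; omega
      exact ⟨fun hlt => absurd (b1.trans hlt) this, fun hlt => by omega⟩
    · have : ¬ s j < s (T + 1) := by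
        rw [h.2 _ _ hj (by omega) (by omega) (by omega), he.at_T1]; omega
      exact ⟨fun _ => by omega, fun _ => b2.trans_le (not_lt.1 this)⟩
  · rw [twist_swapPos sj, twist_not_swapPos si]
    obtain ⟨b1, b2⟩ := hb j hj sj
    have vj := val j sj
    rcases he.gap (by omega) si with g | g
    · have : ¬ s T < s i := by
        rw [h.2 _ _ (by omega) hi (by omega) (by omega), he.at_T0]; omega
      exact ⟨fun _ => by omega, fun _ => (not_lt.1 this).trans_lt b1⟩
    · have : ¬ s i < s (T + 1) := by
        rw [h.2 _ _ hi (by omega) (by omega) (by omega), he.at_T1]; omega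
      exact ⟨fun hlt => absurd (hlt.trans b2) this, fun hlt => by omega⟩
  · rw [twist_not_swapPos si, twist_not_swapPos sj]
    exact h.2 i j hi hj h1 h2

theorem PartInst.groupRev_bounds (he : SwapShape T e) {i m : ℕ} {s : ℕ → α}
    (h : PartInst T e par m s) (him : i < m) (hi : SwapPos T i) :
    s T < groupRev T e par (s i) ∧ groupRev T e par (s i) < s (T + 1) :=
  ((h.inGroup him hi).groupRev he).bounds he (h.1 T (by unfold SwapPos at hi; omega))

/-- Partial instances for `par` become partial instances for `newPar`. -/
theorem PartInst.twist (he : SwapShape T e) {m : ℕ} (hm : m ≤ T + 6) {s : ℕ → α}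
    (h : PartInst T e par m s) : PartInst T e (newPar T e par) m (twist T e par s) := by
  have h4 := he.four_le
  refine ⟨fun i hi => ?_, twist_order he hm h fun i him hi => h.groupRev_bounds he him hi⟩
  have hfix : groupRev T e par (_root_.twist T e par s (i + 1)) = s (i + 1) := by
    by_cases hs : SwapPos T (i + 1)
    · rw [twist_swapPos hs, groupRev_groupRev he]
    · rw [twist_not_swapPos hs,
        groupRev_of_not_inGroup (h.not_inGroup he hi (by omega) (by omega) hs)]
  rw [newPar, hfix, h.1 i hi, Option.map_some, Option.some_inj]
  by_cases hs : SwapPos T i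
  · have hi2 : i = T + 2 := by unfold SwapPos at hs; omega
    subst hi2
    rw [twist_swapPos hs, twist_not_swapPos (by unfold SwapPos; omega), if_pos]
    have b1 := h.swapPos_bounds he (by omega) hs
    have b2 := h.groupRev_bounds he (by omega) hs
    have b3 : s (T + 2 + 1) < s T := by
      rw [h.2 _ _ (by omega) (by omega) (by omega) (by omega), he.at_T0, he.at_T3]; omega
    exact ⟨b3.trans b1.1, b3.trans b2.1⟩
  · rw [twist_not_swapPos hs]
    rcases Nat.eq_zero_or_pos i with rfl | hpos
    · rw [if_neg]
      rintro ⟨hlt, -⟩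
      rw [twist_not_swapPos (by unfold SwapPos; omega),
        h.2 _ _ (by omega) (by omega) (by omega) (by omega), zero_add, he.at_one,
        he.at_zero] at hlt
      omega
    · rw [groupRev_of_not_inGroup (h.not_inGroup he (by omega) hpos (by omega) hs), ite_self]

/-- Partial instances for `newPar` come from partial instances for `par`. -/
theorem PartInst.untwist (he : SwapShape T e) {m : ℕ} (hm : m ≤ T + 6) {s : ℕ → α}
    (h : PartInst T e (newPar T e par) m s) : PartInst T e par m (_root_.twist T e par s) := by
  have h4 := he.four_le
  have overlap : ∀ j < m, 1 ≤ j → ∀ u, InGroup T e par u (s j) →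
      ∃ r, PartInst T e par (j + 1) r ∧ SwapPos T j ∧ groupRev T e par (s j) = r j ∧
        s T = r T ∧ s (T + 1) = r (T + 1) := by
    intro j hjm hj1 u hu
    obtain ⟨r, i, hi, hr, -, hri⟩ := hu.groupRev he
    have hi' : i = T + 2 ∨ i = T + 5 := hi
    have htr : _root_.twist T e par r i = s j := by
      rw [twist_swapPos hi, hri, groupRev_groupRev he]
    obtain ⟨rfl, hagree⟩ := (hr.twist he (by omega)).overlap he hi hj1 (by omega)
      (h.mono hjm) htr
    refine ⟨r, hr, hi, hri.symm, ?_, ?_⟩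
    · rw [← hagree T (by omega), twist_not_swapPos (by unfold SwapPos; omega)]
    · rw [← hagree (T + 1) (by omega), twist_not_swapPos (by unfold SwapPos; omega)]
  have notGroup : ∀ j < m, 1 ≤ j → ¬ SwapPos T j → ∀ u, ¬ InGroup T e par u (s j) := by
    intro j hjm hj1 hs u hu
    obtain ⟨r, -, hi, -⟩ := overlap j hjm hj1 u hu
    exact hs hi
  have bounds : ∀ i < m, SwapPos T i →
      s T < groupRev T e par (s i) ∧ groupRev T e par (s i) < s (T + 1) := by
    intro i him hi
    by_cases hg : ∃ u, InGroup T e par u (s i)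
    · obtain ⟨u, hu⟩ := hg
      obtain ⟨r, hr, -, e1, e2, e3⟩ := overlap i him (by unfold SwapPos at hi; omega) u hu
      rw [e1, e2, e3]
      exact hr.swapPos_bounds he (by omega) hi
    · push Not at hg
      rw [groupRev_of_not_inGroup hg]
      exact h.swapPos_bounds he him hi
  have order := twist_order he hm h bounds
  have step : ∀ i, i + 1 < m → ∃ z, par (_root_.twist T e par s (i + 1)) = some z ∧
      (if s (i + 1) < z ∧ s (i + 1) < groupRev T e par z then groupRev T e par z else z)
        = s i := by
    intro i hi
    have hpar := h.1 i hi
    have hfix : groupRev T e par (s (i + 1)) = _root_.twist T e par s (i + 1) := by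
      by_cases hs : SwapPos T (i + 1)
      · rw [twist_swapPos hs]
      · rw [twist_not_swapPos hs, groupRev_of_not_inGroup (notGroup _ hi (by omega) hs)]
    rw [newPar, hfix, Option.map_eq_some_iff] at hpar
    exact hpar
  have path : ∀ i, i + 1 < m → i ≠ T + 2 →
      par (_root_.twist T e par s (i + 1)) = some (_root_.twist T e par s i) := by
    intro i hi hne
    obtain ⟨z, hz, hzi⟩ := step i hi
    have hs : ¬ SwapPos T i := by unfold SwapPos; omega
    rw [hz, twist_not_swapPos hs, Option.some_inj]
    split_ifs at hzi with hc
    · rcases Nat.eq_zero_or_pos i with rfl | hpos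
      · exfalso
        have hlt := hc.2
        rw [hzi, h.2 _ _ (by omega) (by omega) (by omega) (by omega), zero_add, he.at_one,
          he.at_zero] at hlt
        omega
      · rw [← groupRev_groupRev he (par := par) z, hzi,
          groupRev_of_not_inGroup (notGroup i (by omega) hpos hs)]
    · exact hzi
  refine ⟨fun i hi => ?_, order⟩
  by_cases hne : i = T + 2
  · subst hne
    have hs : SwapPos T (T + 2) := Or.inl rfl
    obtain ⟨z, hz, hzi⟩ := step _ hi
    rw [hz, twist_swapPos hs, Option.some_inj]
    split_ifs at hzi with hc
    · rw [← hzi, groupRev_groupRev he]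
    · subst hzi
      refine absurd ⟨?_, ?_⟩ hc
      · rw [h.2 _ _ (by omega) (by omega) (by omega) (by omega), he.at_T2, he.at_T3]; omega
      · refine lt_trans ?_ (bounds (T + 2) (by omega) hs).1
        rw [h.2 _ _ (by omega) (by omega) (by omega) (by omega), he.at_T0, he.at_T3]; omega
  · exact path i hi hne

theorem inGroup_newPar (he : SwapShape T e) (u w : α) :
    InGroup T e (newPar T e par) u w ↔ InGroup T e par u w := by
  have h1 : ∀ w, InGroup T e (newPar T e par) u w → InGroup T e par u w := by
    rintro w ⟨s, i, hi, hs, rfl, rfl⟩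
    have hi' : i = T + 2 ∨ i = T + 5 := hi
    have := (hs.untwist he (by omega)).inGroup (by omega : i < i + 1) hi
    rw [twist_swapPos hi, twist_not_swapPos (by unfold SwapPos; omega)] at this
    simpa [groupRev_groupRev he] using this.groupRev he
  refine ⟨h1 w, fun hw => ?_⟩
  obtain ⟨s, i, hi, hs, hu, hw'⟩ := hw.groupRev he
  have hi' : i = T + 2 ∨ i = T + 5 := hi
  have := (hs.twist he (by omega)).inGroup (by omega : i < i + 1) hi
  rwa [twist_swapPos hi, twist_not_swapPos (by unfold SwapPos; omega), hu, hw',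
    groupRev_groupRev he] at this

theorem groupRev_newPar (he : SwapShape T e) :
    groupRev T e (newPar T e par) = groupRev T e par := by
  funext w
  have : groupOf T e (newPar T e par) w = groupOf T e par w := by
    ext z; simp only [mem_groupOf, inGroup_newPar he]
  rw [groupRev, groupRev, this]

theorem newPar_newPar (he : SwapShape T e) : newPar T e (newPar T e par) = par := by
  funext w
  rw [newPar, groupRev_newPar he, newPar, groupRev_groupRev he, Option.map_map]
  rcases hz : par w with _ | z
  · rfl
  rw [Option.map_some, Option.some_inj, Function.comp_apply]
  by_cases hg : ∃ u, InGroup T e par u z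
  · obtain ⟨u, hu⟩ := hg
    have hw : groupRev T e par w = w :=
      groupRev_of_not_inGroup fun u' hu' => hu'.parent_not_inGroup he hz u hu
    rw [hw]
    by_cases hc : w < z ∧ w < groupRev T e par z
    · rw [if_pos hc, groupRev_groupRev he, if_pos hc.symm]
    · rw [if_neg hc, if_neg hc]
  · push Not at hg
    simp only [groupRev_of_not_inGroup hg, ite_self]

theorem newPar_acyclic (he : SwapShape T e)
    (h : ∀ v, ¬ Relation.TransGen (fun a b => par b = some a) v v) (v : α) :
    ¬ Relation.TransGen (fun a b => newPar T e par b = some a) v v := by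
  let r : α → α → Prop := Relation.TransGen fun a b => par b = some a
  let r' : α → α → Prop := fun a b => newPar T e par b = some a
  have irr : Std.Irrefl r := ⟨h⟩
  have wf : WellFounded r := Finite.wellFounded_of_trans_of_irrefl r
  have accStep : ∀ {a b}, newPar T e par b = some a → Acc r' a → Acc r' b := by
    intro a b hab ha
    refine Acc.intro b fun c hc => ?_
    obtain rfl : c = a := Option.some_injective _ (hc.symm.trans hab)
    exact ha
  have accGroup : ∀ {u w}, InGroup T e par u w → Acc r' u → Acc r' w := by
    intro u w hw hu
    obtain ⟨s, i, hi, hs, rfl, rfl⟩ := (inGroup_newPar he u w).2 hw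
    have hi' : i = T + 2 ∨ i = T + 5 := hi
    have : ∀ j, T + 1 ≤ j → j < i + 1 → Acc r' (s j) := by
      intro j hj
      induction j, hj using Nat.le_induction with
      | base => exact fun _ => hu
      | succ j hij ih => exact fun hj => accStep (hs.1 j hj) (ih (by omega))
    exact this i (by omega) (by omega)
  have above : ∀ {u w}, InGroup T e par u w → r u w := by
    rintro u w ⟨s, i, hi, hs, rfl, rfl⟩
    exact hs.transGen i (by unfold SwapPos at hi; omega) (by omega)
  have acc : ∀ z, Acc r' z := by
    intro z
    induction z using wf.induction with
    | _ z ih =>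
      by_cases hg : ∃ u, InGroup T e par u z
      · obtain ⟨u, hu⟩ := hg
        exact accGroup hu (ih u (above hu))
      push Not at hg
      refine Acc.intro z fun c hc => ?_
      have hc' : newPar T e par z = some c := hc
      rw [newPar, groupRev_of_not_inGroup hg, Option.map_eq_some_iff] at hc'
      obtain ⟨w, hw, hwc⟩ := hc'
      have hwz : r w z := .single hw
      by_cases hgw : ∃ u, InGroup T e par u w
      · obtain ⟨u, hu⟩ := hgw
        have hau := ih u (Relation.TransGen.trans (above hu) hwz)
        split_ifs at hwc
        · exact hwc ▸ accGroup (hu.groupRev he) hau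
        · exact hwc ▸ accGroup hu hau
      · push Not at hgw
        rw [groupRev_of_not_inGroup hgw, ite_self] at hwc
        exact hwc ▸ ih w hwz
  intro hv
  exact (WellFounded.transGen ⟨acc⟩).irrefl.irrefl v hv

end

namespace RForest

variable {n T : ℕ} {e : ℕ → ℕ}

/-- The forest with parent function `newPar`. -/
noncomputable def swapForest (he : SwapShape T e) (F : RForest n) : RForest n where
  parent := newPar T e F.parent
  acyclic := newPar_acyclic he F.acyclic

theorem swapForest_swapForest (he : SwapShape T e) (F : RForest n) :
    swapForest he (swapForest he F) = F := by
  obtain ⟨p, hp⟩ := F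
  simp only [swapForest, newPar_newPar he]

end RForest

/-- `π` has the relative order prescribed by `e`, except possibly between the swap positions. -/
def AgreesOffSwap {T : ℕ} (e : ℕ → ℕ) (π : Pattern (T + 6)) : Prop :=
  ∀ i j : Fin (T + 6), ¬ (i.val = T + 2 ∧ j.val = T + 5) → ¬ (i.val = T + 5 ∧ j.val = T + 2) →
    (π i < π j ↔ e i < e j)

theorem CContainsPat.swapForest {n T : ℕ} {e : ℕ → ℕ} (he : SwapShape T e) {F : RForest n}
    {π π' : Pattern (T + 6)} (hπ : AgreesOffSwap e π) (hπ' : AgreesOffSwap e π')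
    (hswap : ∀ i j : Fin (T + 6), SwapPos T i → SwapPos T j → (π i < π j ↔ π' j < π' i))
    (h : CContainsPat F π) : CContainsPat (F.swapForest he) π' := by
  obtain ⟨v, hpath, hord⟩ := h
  let s : ℕ → Fin n := fun i => v ⟨min i (T + 5), by omega⟩
  have hs : ∀ i : Fin (T + 6), s i = v i := fun i => congrArg v (Fin.ext (by simp; omega))
  have hs' : ∀ i (hi : i < T + 6), s i = v ⟨i, hi⟩ := fun i hi => hs ⟨i, hi⟩
  have hinst : PartInst T e F.parent (T + 6) s := by
    refine ⟨fun i hi => ?_, fun i j hi hj h1 h2 => ?_⟩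
    · rw [hs' _ hi, hs' i (by omega)]
      exact hpath _ _ rfl
    · rw [hs' _ hi, hs' _ hj, hord]
      exact hπ ⟨i, hi⟩ ⟨j, hj⟩ h1 h2
  have htw := hinst.twist he le_rfl
  refine ⟨fun i => twist T e F.parent s i, fun i j hij => ?_, fun i j => ?_⟩
  · have := htw.1 i (by omega)
    rw [← hij] at this
    exact this
  by_cases hi : SwapPos T i ∧ SwapPos T j
  · obtain ⟨hi, hj⟩ := hi
    have gi := hinst.inGroup i.2 hi
    have gj := hinst.inGroup j.2 hj
    show twist T e F.parent s i < twist T e F.parent s j ↔ _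
    rw [twist_swapPos hi, twist_swapPos hj, ← hswap j i hj hi, ← hord, ← hs, ← hs]
    refine ⟨fun hlt => ?_, groupRev_lt he gj gi⟩
    have := groupRev_lt he (gi.groupRev he) (gj.groupRev he) hlt
    rwa [groupRev_groupRev he, groupRev_groupRev he] at this
  · have h1 : ¬ (i.val = T + 2 ∧ j.val = T + 5) := fun h => hi ⟨.inl h.1, .inr h.2⟩
    have h2 : ¬ (i.val = T + 5 ∧ j.val = T + 2) := fun h => hi ⟨.inr h.1, .inl h.2⟩
    rw [htw.2 i j i.2 j.2 h1 h2, hπ' i j h1 h2]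

theorem cForestWilfEquiv_of_agreesOffSwap {T : ℕ} {e : ℕ → ℕ} (he : SwapShape T e)
    {π π' : Pattern (T + 6)} (hπ : AgreesOffSwap e π) (hπ' : AgreesOffSwap e π')
    (hswap : ∀ i j : Fin (T + 6), SwapPos T i → SwapPos T j → (π i < π j ↔ π' j < π' i)) :
    CForestWilfEquiv π π' := by
  intro n
  have fwd : ∀ F : RForest n, CContainsPat F π → CContainsPat (F.swapForest he) π' :=
    fun F => CContainsPat.swapForest he hπ hπ' hswap
  have bwd : ∀ F : RForest n, CContainsPat F π' → CContainsPat (F.swapForest he) π :=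
    fun F => CContainsPat.swapForest he hπ' hπ fun i j hi hj => (hswap j i hj hi).symm
  refine Nat.card_congr
    ⟨fun F => ⟨F.1.swapForest he, fun h => F.2 ?_⟩, fun F => ⟨F.1.swapForest he, fun h => F.2 ?_⟩,
      fun F => Subtype.ext (RForest.swapForest_swapForest he F.1),
      fun F => Subtype.ext (RForest.swapForest_swapForest he F.1)⟩
  · simpa [RForest.swapForest_swapForest] using bwd _ h
  · simpa [RForest.swapForest_swapForest] using fwd _ h

/-- The permutation `0, 7, 8, …, T + 5, 2, 5, 3, 1, 6, 4`. -/
def basePatternFun (T i : ℕ) : ℕ :=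
  if i = 0 then 0 else if i = 1 then 7 else if i < T then i + 6 else if i = T then 2 else
  if i = T + 1 then 5 else if i = T + 2 then 3 else if i = T + 3 then 1 else
  if i = T + 4 then 6 else 4

theorem basePatternFun_lt {T : ℕ} (hT : 4 ≤ T) (i : ℕ) :
    basePatternFun T i < T + 6 := by
  unfold basePatternFun; split_ifs <;> omega

theorem basePatternFun_cases {T : ℕ} (hT : 4 ≤ T) (i : ℕ) :
    i = 0 ∧ basePatternFun T i = 0 ∨ i = 1 ∧ basePatternFun T i = 7 ∨
    2 ≤ i ∧ i < T ∧ basePatternFun T i = i + 6 ∨ i = T ∧ basePatternFun T i = 2 ∨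
    i = T + 1 ∧ basePatternFun T i = 5 ∨ i = T + 2 ∧ basePatternFun T i = 3 ∨
    i = T + 3 ∧ basePatternFun T i = 1 ∨ i = T + 4 ∧ basePatternFun T i = 6 ∨
    T + 5 ≤ i ∧ basePatternFun T i = 4 := by
  unfold basePatternFun; split_ifs <;> omega

theorem basePatternFun_inj {T i j : ℕ} (hT : 4 ≤ T) (hi : i < T + 6) (hj : j < T + 6)
    (h : basePatternFun T i = basePatternFun T j) : i = j := by
  have hi' := basePatternFun_cases hT i
  rw [h] at hi'
  rcases basePatternFun_cases hT j with c | c | c | c | c | c | c | c | c <;> omega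

/-- `basePatternFun` as a pattern. -/
noncomputable def basePattern (T : ℕ) (hT : 4 ≤ T) : Pattern (T + 6) :=
  Equiv.ofBijective (fun i => ⟨basePatternFun T i, basePatternFun_lt hT i⟩)
    (Finite.injective_iff_bijective.1 fun _ _ h =>
      Fin.ext (basePatternFun_inj hT (Fin.is_lt _) (Fin.is_lt _) (congrArg Fin.val h)))

theorem basePattern_val (T : ℕ) (hT : 4 ≤ T) (i : Fin (T + 6)) :
    (basePattern T hT i).val = basePatternFun T i := rfl

/-- The values of a pattern as a function on the naturals. -/
def Pattern.vals {T : ℕ} (π : Pattern (T + 6)) (i : ℕ) : ℕ := (π ⟨min i (T + 5), by omega⟩).val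

theorem Pattern.vals_of_lt {T : ℕ} (π : Pattern (T + 6)) {i : ℕ} (hi : i < T + 6) :
    π.vals i = (π ⟨i, hi⟩).val := by
  unfold Pattern.vals; congr; omega

theorem exists_nontrivial_equiv {T : ℕ} {π : Pattern (T + 6)} (h : SwapShape T π.vals) :
    ∃ π' : Pattern (T + 6), π' ≠ π ∧ π' ≠ Pattern.compl π ∧ CForestWilfEquiv π π' := by
  have h4 := h.four_le
  have val : ∀ i : Fin (T + 6), (π i).val = π.vals i := fun i => (π.vals_of_lt i.2).symm
  let a : Fin (T + 6) := ⟨3, by omega⟩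
  let b : Fin (T + 6) := ⟨4, by omega⟩
  let π' : Pattern (T + 6) := π.trans (Equiv.swap a b)
  have val' : ∀ i, (π' i).val = if (π i).val = 3 then 4 else if (π i).val = 4 then 3
      else (π i).val := by
    intro i
    simp only [π', Equiv.trans_apply, Equiv.swap_apply_def, Fin.ext_iff, a, b]
    split_ifs <;> rfl
  have hX : (π ⟨T + 2, by omega⟩).val = 3 := by rw [val]; exact h.at_T2
  have hY : (π ⟨T + 5, by omega⟩).val = 4 := by rw [val]; exact h.at_T5
  have h0 : (π ⟨0, by omega⟩).val = 0 := by rw [val]; exact h.at_zero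
  have only : ∀ i : Fin (T + 6), ¬ SwapPos T i → (π i).val ≤ 2 ∨ 5 ≤ (π i).val :=
    fun i hi => by rw [val]; exact h.gap i.2 hi
  have at_swap : ∀ i : Fin (T + 6), SwapPos T i →
      (i.val = T + 2 ∧ (π i).val = 3) ∨ (i.val = T + 5 ∧ (π i).val = 4) := by
    rintro i (hi | hi)
    · exact .inl ⟨hi, by rw [← hX, show i = ⟨T + 2, by omega⟩ from Fin.ext hi]⟩
    · exact .inr ⟨hi, by rw [← hY, show i = ⟨T + 5, by omega⟩ from Fin.ext hi]⟩
  refine ⟨π', fun heq => ?_, fun heq => ?_, cForestWilfEquiv_of_agreesOffSwap h ?_ ?_ ?_⟩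
  · have := val' ⟨T + 2, by omega⟩
    rw [heq, hX] at this
    simp at this
  · have := val' ⟨0, by omega⟩
    rw [heq, h0] at this
    have hc : (Pattern.compl π ⟨0, by omega⟩).val = T + 6 - ((π ⟨0, by omega⟩).val + 1) := rfl
    rw [hc, h0] at this
    simp at this
  · intro i j _ _
    rw [Fin.lt_def, val, val]
  · intro i j h1 h2
    rw [Fin.lt_def, val', val', ← val, ← val]
    by_cases hi : SwapPos T i <;> by_cases hj : SwapPos T j
    · have := at_swap i hi
      have := at_swap j hj
      split_ifs <;> omega
    · have := at_swap i hi
      have := only j hj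
      split_ifs <;> omega
    · have := only i hi
      have := at_swap j hj
      split_ifs <;> omega
    · have := only i hi
      have := only j hj
      split_ifs <;> omega
  · intro i j hi hj
    have := at_swap i hi
    have := at_swap j hj
    rw [Fin.lt_def, Fin.lt_def, val', val']
    split_ifs <;> omega

theorem factorial_le_card_nontrivial (T : ℕ) (hT : 4 ≤ T) :
    (T - 2).factorial ≤ Nat.card {π : Pattern (T + 6) // ∃ π' : Pattern (T + 6),
      π' ≠ π ∧ π' ≠ Pattern.compl π ∧ CForestWilfEquiv π π'} := by
  classical
  let P : Fin (T + 6) → Prop := fun i => 2 ≤ i.val ∧ i.val < T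
  let g : Equiv.Perm {i // P i} → Pattern (T + 6) :=
    fun τ => (Equiv.Perm.ofSubtype τ).trans (basePattern T hT)
  have hval : ∀ τ (i : ℕ) (hi : i < T + 6), ¬ (2 ≤ i ∧ i < T) →
      (g τ).vals i = basePatternFun T i := by
    intro τ i hi hP
    rw [Pattern.vals_of_lt _ hi]
    simp only [g, Equiv.trans_apply]
    rw [Equiv.Perm.ofSubtype_apply_of_not_mem τ (show ¬ P ⟨i, hi⟩ from hP), basePattern_val]
  have hg : ∀ τ, SwapShape T (g τ).vals := by
    intro τ
    refine ⟨hT, ?_, ?_, ?_, ?_, ?_, ?_, ?_, ?_, ?_⟩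
    case refine_3 =>
      intro i h2 hi
      rw [Pattern.vals_of_lt _ (by omega)]
      simp only [g, Equiv.trans_apply]
      rw [Equiv.Perm.ofSubtype_apply_of_mem τ (show P ⟨i, by omega⟩ from ⟨h2, hi⟩),
        basePattern_val]
      have := (τ ⟨⟨i, by omega⟩, ⟨h2, hi⟩⟩).2
      simp only [P] at this
      have := basePatternFun_cases hT (τ ⟨⟨i, by omega⟩, ⟨h2, hi⟩⟩).1.val
      omega
    all_goals
      rw [hval τ _ (by omega) (by omega)]
      unfold basePatternFun
      repeat first | rw [if_pos (by omega)] | rw [if_neg (by omega)]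
  have hinj : Function.Injective g := fun τ τ' h =>
    Equiv.Perm.ofSubtype_injective (Equiv.ext fun i =>
      (basePattern T hT).injective (congrArg (fun σ : Pattern (T + 6) => σ i) h))
  have hcard : Nat.card {i // P i} = T - 2 := by
    let f : Fin (T - 2) ≃ {i // P i} :=
      { toFun := fun i => ⟨⟨i + 2, by omega⟩, by simp only [P]; omega⟩
        invFun := fun i => ⟨i.1.val - 2, by have := i.2; simp only [P] at this; omega⟩
        left_inv := fun i => by simp
        right_inv := fun i => by
          have := i.2
          simp only [P] at this
          ext
          simp only
          omega }
    rw [← Nat.card_congr f, Nat.card_eq_fintype_card, Fintype.card_fin]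
  rw [← hcard, ← Nat.card_perm]
  exact Nat.card_le_card_of_injective
    (fun τ => ⟨g τ, exists_nontrivial_equiv (hg τ)⟩)
    fun τ τ' h => hinj (congrArg Subtype.val h)

theorem eventually_pow_mul_factorial_le (c : ℝ) (hc0 : 0 < c) (hc1 : c < 1) :
    ∃ N : ℕ, ∀ n : ℕ, N < n → c ^ n * (n.factorial : ℝ) ≤ ((n - 8).factorial : ℝ) := by
  have ht := tendsto_pow_const_mul_const_pow_of_abs_lt_one 8 (abs_lt.2 ⟨by linarith, hc1⟩)
  obtain ⟨N, hN⟩ := Filter.eventually_atTop.1 (ht.eventually (ge_mem_nhds zero_lt_one))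
  refine ⟨max N 8, fun n hn => ?_⟩
  have h8 : 8 ≤ n := by omega
  have hfac : (n.factorial : ℝ) ≤ (n - 8).factorial * (n : ℝ) ^ 8 := by
    rw [← Nat.factorial_mul_descFactorial h8]
    push_cast
    gcongr
    exact_mod_cast Nat.descFactorial_le_pow n 8
  calc c ^ n * (n.factorial : ℝ) ≤ c ^ n * ((n - 8).factorial * (n : ℝ) ^ 8) := by gcongr
    _ = (n : ℝ) ^ 8 * c ^ n * (n - 8).factorial := by ring
    _ ≤ 1 * (n - 8).factorial := by gcongr; exact hN n (by omega)
    _ = _ := one_mul _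

/-- For every `0 < c < 1`, for all sufficiently large `n`, at least `c ^ n * n!` patterns
of length `n` satisfy a nontrivial c-forest-Wilf equivalence. -/
theorem many_nontrivial_cForestWilf_equivalences (c : ℝ) (hc0 : 0 < c) (hc1 : c < 1) :
    ∃ N : ℕ, ∀ n : ℕ, N < n →
      c ^ n * (n.factorial : ℝ) ≤
        (Nat.card {π : Pattern n // ∃ π' : Pattern n,
          π' ≠ π ∧ π' ≠ Pattern.compl π ∧ CForestWilfEquiv π π'} : ℝ) := by
  obtain ⟨N, hN⟩ := eventually_pow_mul_factorial_le c hc0 hc1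
  refine ⟨max N 10, fun n hn => (hN n (by omega)).trans ?_⟩
  obtain ⟨T, rfl⟩ : ∃ T, n = T + 6 := ⟨n - 6, by omega⟩
  exact_mod_cast factorial_le_card_nontrivial T (by omega)
end

section
/- If two patterns π and π′ of length k are super-strongly c-forest-Wilf equivalent, then π′ = π or π′ is the complement of π. -/
/-- `v` is a consecutive instance of `π` in the (unlabeled) forest `F` with respect to the
labeling `ℓ`: a downward path whose labels `ℓ (v i)` are in the same relative order as `π`. -/
def IsConsInstanceL {n k : ℕ} (F : RForest n) (ℓ : Fin n ≃ Fin n) (π : Pattern k)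
    (v : Fin k → Fin n) : Prop :=
  (∀ i j : Fin k, (j : ℕ) = (i : ℕ) + 1 → F.parent (v j) = some (v i)) ∧
  (∀ i j : Fin k, ℓ (v i) < ℓ (v j) ↔ π i < π j)

/-- Super-strong c-forest-Wilf equivalence: for every unlabeled rooted forest `F` on `n`
vertices and every set `S` of downward paths of `k` vertices in `F`, the number of
labelings whose set of consecutive instances of `π` is exactly `S` equals the
corresponding number for `π'`. -/
def SuperStrongCEquiv {k : ℕ} (π π' : Pattern k) : Prop :=
  ∀ (n : ℕ) (F : RForest n) (S : Set (Fin k → Fin n)),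
    (∀ v ∈ S, ∀ i j : Fin k, (j : ℕ) = (i : ℕ) + 1 → F.parent (v j) = some (v i)) →
    Nat.card {ℓ : Fin n ≃ Fin n // ∀ v, (IsConsInstanceL F ℓ π v ↔ v ∈ S)} =
    Nat.card {ℓ : Fin n ≃ Fin n // ∀ v, (IsConsInstanceL F ℓ π' v ↔ v ∈ S)}

/-! ### Generalities on super-strong equivalence -/

theorem SuperStrongCEquiv.symm {k : ℕ} {π π' : Pattern k} (h : SuperStrongCEquiv π π') :
    SuperStrongCEquiv π' π := fun n F S hS => (h n F S hS).symm

theorem Pattern.compl_compl {k : ℕ} (π : Pattern k) : π.compl.compl = π := by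
  ext x
  simp [Pattern.compl]

theorem isConsInstanceL_compl {n k : ℕ} (F : RForest n) (ℓ : Fin n ≃ Fin n) (π : Pattern k)
    (v : Fin k → Fin n) :
    IsConsInstanceL F (ℓ.trans Fin.revPerm) π.compl v ↔ IsConsInstanceL F ℓ π v := by
  refine and_congr Iff.rfl ?_
  simp only [Pattern.compl, Equiv.trans_apply, Equiv.coe_fn_mk, Fin.revPerm_apply, Fin.rev_lt_rev]
  exact forall_comm

theorem SuperStrongCEquiv.compl_left {k : ℕ} {π π' : Pattern k} (h : SuperStrongCEquiv π π') :
    SuperStrongCEquiv π.compl π' := by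
  intro n F S hS
  rw [← h n F S hS]
  refine (Nat.card_congr (Equiv.subtypeEquiv (Equiv.equivCongr (Equiv.refl _) Fin.revPerm) ?_)).symm
  intro ℓ
  refine forall_congr' fun v => ?_
  exact iff_congr (isConsInstanceL_compl F ℓ π v).symm Iff.rfl

/-- Labelings of `V` for which every path in `S` is an instance of `π`. -/
def ForcedLabelings {V : Type} [Fintype V] {k : ℕ} (S : Set (Fin k → V)) (π : Pattern k) : Type :=
  {ℓ : V ≃ Fin (Fintype.card V) // ∀ v ∈ S, ∀ x y, ℓ (v x) < ℓ (v y) ↔ π x < π y}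

/-- Super-strong equivalence also equates the numbers of labelings whose set of instances
contains a given set of paths, in forests on an arbitrary finite vertex type. -/
theorem SuperStrongCEquiv.card_forcedLabelings {V : Type} [Fintype V] {k : ℕ} {π π' : Pattern k}
    (h : SuperStrongCEquiv π π') (par : V → Option V) (depth : V → ℕ)
    (hdepth : ∀ u v, par v = some u → depth u < depth v) (S : Set (Fin k → V))
    (hS : ∀ v ∈ S, ∀ i j : Fin k, (j : ℕ) = (i : ℕ) + 1 → par (v j) = some (v i)) :
    Nat.card (ForcedLabelings S π) = Nat.card (ForcedLabelings S π') := by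
  classical
  set n := Fintype.card V
  let e : V ≃ Fin n := Fintype.equivFin V
  let F : RForest n :=
    { parent := fun v => (par (e.symm v)).map e
      acyclic := by
        have key : ∀ a b, Relation.TransGen
            (fun a b : Fin n => (par (e.symm b)).map e = some a) a b →
            depth (e.symm a) < depth (e.symm b) := by
          have step : ∀ a b : Fin n, (par (e.symm b)).map e = some a →
              depth (e.symm a) < depth (e.symm b) := by
            intro a b hab
            obtain ⟨u, hu, rfl⟩ := Option.map_eq_some_iff.1 hab
            exact hdepth _ _ (by simpa using hu)
          intro a b hab
          induction hab with
          | single hab => exact step _ _ hab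
          | tail _ hbc ih => exact ih.trans (step _ _ hbc)
        exact fun v hv => lt_irrefl _ (key v v hv) }
  have hpath : ∀ v ∈ S, ∀ i j : Fin k, (j : ℕ) = (i : ℕ) + 1 →
      F.parent (e (v j)) = some (e (v i)) := by
    intro v hv i j hij
    simp [F, hS v hv i j hij]
  have sum_eq : ∀ ρ : Pattern k, Nat.card (ForcedLabelings S ρ) =
      ∑ T : Set (Fin k → Fin n), if (∀ v ∈ S, (fun x => e (v x)) ∈ T) then
        Nat.card {ℓ : Fin n ≃ Fin n // ∀ v, (IsConsInstanceL F ℓ ρ v ↔ v ∈ T)} else 0 := by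
    intro ρ
    have e1 : ForcedLabelings S ρ ≃
        {ℓ : Fin n ≃ Fin n // ∀ v ∈ S, IsConsInstanceL F ℓ ρ (fun x => e (v x))} := by
      refine Equiv.subtypeEquiv (Equiv.equivCongr e (Equiv.refl _)) ?_
      intro ℓ
      refine forall₂_congr fun v hv => ?_
      simp only [IsConsInstanceL, Equiv.equivCongr_apply_apply, Equiv.symm_apply_apply,
        Equiv.refl_apply]
      exact (and_iff_right (hpath v hv)).symm
    have e2 := Equiv.sigmaFiberEquiv
      (fun ℓ : {ℓ : Fin n ≃ Fin n // ∀ v ∈ S, IsConsInstanceL F ℓ ρ (fun x => e (v x))} =>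
        {v | IsConsInstanceL F ℓ.1 ρ v})
    rw [Nat.card_congr (e1.trans e2.symm), Nat.card_sigma]
    refine Finset.sum_congr rfl fun T _ => ?_
    split_ifs with hT
    · refine Nat.card_congr ⟨fun ℓ => ⟨ℓ.1.1, Set.ext_iff.1 ℓ.2⟩,
        fun ℓ => ⟨⟨ℓ.1, fun v hv => (ℓ.2 _).2 (hT v hv)⟩, Set.ext ℓ.2⟩, ?_, ?_⟩
      · intro ℓ; rfl
      · intro ℓ; rfl
    · have : IsEmpty {ℓ : {ℓ : Fin n ≃ Fin n // ∀ v ∈ S, IsConsInstanceL F ℓ ρ (fun x => e (v x))} //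
          {v | IsConsInstanceL F ℓ.1 ρ v} = T} :=
        ⟨fun ℓ => hT fun v hv => by rw [← ℓ.2]; exact ℓ.1.2 v hv⟩
      exact Nat.card_of_isEmpty
  rw [sum_eq, sum_eq]
  refine Finset.sum_congr rfl fun T _ => ?_
  split_ifs with hT
  · by_cases hp : ∀ v ∈ T, ∀ i j : Fin k, (j : ℕ) = (i : ℕ) + 1 → F.parent (v j) = some (v i)
    · exact h n F T hp
    · have : ∀ ρ : Pattern k,
          IsEmpty {ℓ : Fin n ≃ Fin n // ∀ v, (IsConsInstanceL F ℓ ρ v ↔ v ∈ T)} :=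
        fun ρ => ⟨fun ℓ => hp fun v hv => ((ℓ.2 v).2 hv).1⟩
      have h1 := this π
      have h2 := this π'
      rw [Nat.card_of_isEmpty, Nat.card_of_isEmpty]
  · rfl

/-! ### Sorting lemmas -/

theorem exists_equiv_fin_of_lt {V : Type*} [Fintype V] (f : V → ℕ) :
    ∃ ℓ : V ≃ Fin (Fintype.card V), ∀ a b, f a < f b → ℓ a < ℓ b := by
  let e := Fintype.equivFin V
  let σ := Tuple.sort (f ∘ e.symm)
  refine ⟨e.trans σ.symm, fun a b hab => ?_⟩
  by_contra hlt
  have hm := Tuple.monotone_sort (f ∘ e.symm) (not_lt.1 hlt)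
  simp [σ] at hm
  omega

theorem exists_perm_lt_of_lt {X : Type*} [Fintype X] (f g : X → ℕ) (hf : Function.Injective f) :
    ∃ σ : Equiv.Perm X, ∀ x y, g x < g y → f (σ x) < f (σ y) := by
  obtain ⟨a, ha⟩ := exists_equiv_fin_of_lt f
  obtain ⟨b, hb⟩ := exists_equiv_fin_of_lt g
  refine ⟨b.trans a.symm, fun x y hxy => ?_⟩
  have h1 := hb x y hxy
  refine lt_of_le_of_ne (not_lt.1 fun h2 => ?_) fun h2 => ?_
  · have := ha _ _ h2
    simp at this
    exact lt_asymm h1 this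
  · have := hf h2
    simp at this
    exact h1.ne (by rw [this])

/-! ### Bounds on numbers of labelings -/

/-- If the values outside `B` of the equivalences in `P` lie in a set `T`, then `P` has at most
`|T| ^ |Bᶜ| * |B|!` members. -/
theorem card_equiv_le_of_values {V W : Type*} [Fintype V] [DecidableEq V] [Fintype W]
    [DecidableEq W] (P : (V ≃ W) → Prop) (B : V → Prop) [DecidablePred B] (T : Finset W)
    (hT : ∀ ℓ, P ℓ → ∀ v, ¬ B v → ℓ v ∈ T) :
    Nat.card {ℓ // P ℓ} ≤
      T.card ^ Fintype.card {v // ¬ B v} * (Fintype.card {v // B v}).factorial := by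
  classical
  rw [Nat.card_eq_fintype_card, Fintype.card_subtype]
  let r : (V ≃ W) → {v // ¬ B v} → W := fun ℓ v => ℓ v
  have hfib : ∀ g ∈ Fintype.piFinset (fun _ : {v // ¬ B v} => T),
      ((Finset.univ.filter P).filter (fun ℓ => r ℓ = g)).card ≤
        (Fintype.card {v // B v}).factorial := by
    intro g _
    rcases ((Finset.univ.filter P).filter (fun ℓ => r ℓ = g)).eq_empty_or_nonempty with h0 | ⟨ℓ₀, h0⟩
    · simp [h0]
    · simp only [Finset.mem_filter, Finset.mem_univ, true_and] at h0
      rw [← Fintype.card_perm, Fintype.card_congr (Equiv.Perm.subtypeEquivSubtypePerm B),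
        Fintype.card_subtype]
      refine Finset.card_le_card_of_injOn (fun ℓ => ℓ.trans ℓ₀.symm) ?_ ?_
      · intro ℓ hℓ
        simp only [Finset.coe_filter, Finset.mem_filter, Finset.mem_univ, true_and,
          Set.mem_ofPred_eq] at hℓ ⊢
        intro v hv
        have h1 : ℓ v = ℓ₀ v := congrFun (hℓ.2.trans h0.2.symm) ⟨v, hv⟩
        simp [h1]
      · intro a _ b _ hab
        ext v
        simpa using congrArg (fun f : V ≃ V => f v) hab
  have := Finset.card_le_mul_card_image_of_maps_to
    (f := r) (s := Finset.univ.filter P) (t := Fintype.piFinset fun _ => T)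
    (fun ℓ hℓ => Fintype.mem_piFinset.2 fun v => hT ℓ (Finset.mem_filter.1 hℓ).2 v v.2) _ hfib
  refine this.trans_eq ?_
  rw [mul_comm]
  simp

/-- If each rearrangement of `ℓ₀` on `B` can be brought into `P` by permuting `X`,
then `|B|! ≤ |P| * |X|!`. -/
theorem factorial_le_card_equiv_mul {V W X : Type*} [Fintype V] [DecidableEq V] [Fintype W]
    [DecidableEq W] [Fintype X] [DecidableEq X] (P : (V ≃ W) → Prop) (B : V → Prop)
    [DecidablePred B] (ℓ₀ : V ≃ W) (ext : Equiv.Perm X → Equiv.Perm V)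
    (hP : ∀ h : Equiv.Perm {v // B v}, ∃ σ : Equiv.Perm X,
      P ((ext σ).trans ((Equiv.Perm.ofSubtype h).trans ℓ₀))) :
    (Fintype.card {v // B v}).factorial ≤ Nat.card {ℓ // P ℓ} * (Fintype.card X).factorial := by
  classical
  choose σ hσ using hP
  rw [← Fintype.card_perm, ← Fintype.card_perm, Nat.card_eq_fintype_card, ← Fintype.card_prod]
  refine Fintype.card_le_of_injective (fun h => (⟨_, hσ h⟩, σ h)) ?_
  intro a b hab
  simp only [Prod.mk.injEq, Subtype.mk.injEq] at hab
  obtain ⟨h1, h2⟩ := hab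
  rw [h2] at h1
  apply Equiv.Perm.ofSubtype_injective
  ext v
  simpa using congrArg (fun f : V ≃ W => f ((ext (σ b)).symm v)) h1

/-! ### The test forest -/

/-- Vertices of the test forest: a spine, a second branch and `m` leaves. -/
abbrev TestVertex (k m : ℕ) := Fin k ⊕ (Fin k ⊕ Fin m)

namespace TestVertex

variable {κ m : ℕ}

/-- The branch hanging from the `i`-th spine vertex. -/
def branch (i j : Fin (κ + 2)) : TestVertex (κ + 2) m :=
  if j = 0 then .inl i else .inr (.inl j)

/-- The path that follows the branch and ends in the leaf `l`. -/
def leafPath (i : Fin (κ + 2)) (l : Fin m) (j : Fin (κ + 2)) : TestVertex (κ + 2) m :=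
  if j = Fin.last _ then .inr (.inr l) else branch i j

/-- The vertex before `j`. -/
def pred (j : Fin (κ + 2)) : Fin (κ + 2) := ⟨j - 1, by omega⟩

/-- Parents in the test forest. -/
def parent (i : Fin (κ + 2)) : TestVertex (κ + 2) m → Option (TestVertex (κ + 2) m)
  | .inl x => if x = 0 then none else some (.inl (pred x))
  | .inr (.inl j) => if j = 0 then none else some (branch i (pred j))
  | .inr (.inr _) => some (branch i (pred (Fin.last _)))

/-- A function that increases along edges. -/
def depth : TestVertex (κ + 2) m → ℕ
  | .inl x => x
  | .inr (.inl j) => κ + 2 + j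
  | .inr (.inr _) => 3 * (κ + 2)

theorem depth_branch_le (i j : Fin (κ + 2)) : depth (branch i j : TestVertex (κ + 2) m) ≤ κ + 2 + j := by
  unfold branch
  split_ifs with h <;> simp only [depth] <;> omega

theorem depth_lt_of_parent (i : Fin (κ + 2)) (u v : TestVertex (κ + 2) m)
    (h : parent i v = some u) : depth u < depth v := by
  rcases v with x | j | l
  · simp only [parent] at h
    split_ifs at h with hx
    obtain rfl := Option.some.inj h
    have : (x : ℕ) ≠ 0 := fun h0 => hx (Fin.ext h0)
    simp only [depth, pred]
    omega
  · simp only [parent] at h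
    split_ifs at h with hx
    obtain rfl := Option.some.inj h
    have : (j : ℕ) ≠ 0 := fun h0 => hx (Fin.ext h0)
    refine (depth_branch_le _ _).trans_lt ?_
    simp only [depth, pred]
    omega
  · obtain rfl := Option.some.inj h
    refine (depth_branch_le _ _).trans_lt ?_
    simp only [depth, pred, Fin.val_last]
    omega

/-- The spine together with all leaf paths. -/
def paths (i : Fin (κ + 2)) : Set (Fin (κ + 2) → TestVertex (κ + 2) m) :=
  insert Sum.inl (Set.range (leafPath i))

theorem parent_of_mem_paths (i : Fin (κ + 2)) (v : Fin (κ + 2) → TestVertex (κ + 2) m)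
    (hv : v ∈ paths i) (x y : Fin (κ + 2)) (h : (y : ℕ) = x + 1) :
    parent i (v y) = some (v x) := by
  have hy : y ≠ 0 := fun h0 => by simp [h0] at h
  have hp : pred y = x := Fin.ext (by simp [pred, h])
  have hx : x ≠ Fin.last _ := fun h0 => by
    have := y.2
    simp [h0] at h
    omega
  rcases hv with rfl | ⟨l, rfl⟩
  · simp [parent, hy, hp]
  · by_cases hl : y = Fin.last _
    · subst hl
      simp [leafPath, parent, hp, hx]
    · simp [leafPath, hl, hx, branch, hy, parent, hp]

/-- The vertices that can be interleaved with the leaves. -/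
def Loose (π : Pattern (κ + 2)) (i : Fin (κ + 2)) : TestVertex (κ + 2) m → Prop
  | .inl x => π x < π i
  | .inr (.inl j) => j = 0 ∨ j = Fin.last _
  | .inr (.inr _) => True

noncomputable instance (π : Pattern (κ + 2)) (i : Fin (κ + 2)) :
    DecidablePred (Loose (m := m) π i) := fun _ => Classical.dec _

theorem card_loose (π : Pattern (κ + 2)) (i : Fin (κ + 2)) :
    Fintype.card {v : TestVertex (κ + 2) m // Loose π i v} =
      π i + (Fintype.card {j : Fin (κ + 2) // j = 0 ∨ j = Fin.last _} + m) := by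
  rw [Fintype.card_congr Equiv.subtypeSum, Fintype.card_sum]
  congr 1
  · have e : {x : Fin (κ + 2) // Loose (m := m) π i (.inl x)} ≃ {y : Fin (κ + 2) // y < π i} :=
      π.subtypeEquiv fun _ => Iff.rfl
    rw [Fintype.card_congr e]
    rw [Fintype.card_subtype, Finset.filter_gt_eq_Iio, Fin.card_Iio]
  · rw [Fintype.card_congr Equiv.subtypeSum, Fintype.card_sum]
    congr 1
    · exact Fintype.card_congr (Equiv.refl _)
    · have e : {l : Fin m // Loose π i (.inr (.inr l))} ≃ Fin m :=
        Equiv.subtypeUnivEquiv fun _ => trivial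
      rw [Fintype.card_congr e, Fintype.card_fin]

theorem card_forcedLabelings_le (π : Pattern (κ + 2)) (hπ : π (Fin.last _) < π 0)
    (i : Fin (κ + 2)) :
    Nat.card (ForcedLabelings (paths (m := m) i) π) ≤
      (4 * (κ + 2)) ^ (2 * (κ + 2)) *
        (Fintype.card {v : TestVertex (κ + 2) m // Loose π i v}).factorial := by
  let N := Fintype.card (TestVertex (κ + 2) m)
  have hN : N = 2 * (κ + 2) + m := by simp [N]; omega
  let T : Finset (Fin N) := Finset.univ.filter fun t => (t : ℕ) < 2 * (κ + 2) ∨ m ≤ t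
  have hTcard : T.card ≤ 4 * (κ + 2) := by
    have : T.card ≤ (Finset.range (2 * (κ + 2)) ∪ Finset.Ico m N).card := by
      refine Finset.card_le_card_of_injOn Fin.val ?_ Fin.val_injective.injOn
      intro t ht
      have h1 := t.2
      have h2 : (t : ℕ) < 2 * (κ + 2) ∨ m ≤ t := by simpa [T] using ht
      simp
      omega
    have h2 := Finset.card_union_le (Finset.range (2 * (κ + 2))) (Finset.Ico m N)
    simp at h2
    omega
  have hB : Fintype.card {v : TestVertex (κ + 2) m // ¬ Loose π i v} ≤ 2 * (κ + 2) := by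
    have h1 := Fintype.card_subtype_compl (Loose (m := m) π i)
    have h2 := card_loose (m := m) π i
    change _ = N - _ at h1
    omega
  have hT : ∀ ℓ : TestVertex (κ + 2) m ≃ Fin N,
      (∀ v ∈ paths i, ∀ x y, ℓ (v x) < ℓ (v y) ↔ π x < π y) →
      ∀ v, ¬ Loose π i v → ℓ v ∈ T := by
    intro ℓ hℓ v hv
    have hside : (∀ l, ℓ (.inr (.inr l)) < ℓ v) ∨ (∀ l, ℓ v < ℓ (.inr (.inr l))) := by
      have hleaf : ∀ l, ∀ x y, ℓ (leafPath i l x) < ℓ (leafPath i l y) ↔ π x < π y :=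
        fun l => hℓ _ (Set.mem_insert_of_mem _ ⟨l, rfl⟩)
      rcases v with x | j | l
      · left
        intro l
        have h1 := (hleaf l (Fin.last _) 0).2 hπ
        simp only [leafPath, branch, if_true, (Fin.last_pos.ne : (0 : Fin (κ + 2)) ≠ _), if_false]
          at h1
        refine h1.trans_le (not_lt.1 fun h2 => hv ?_)
        exact (hℓ _ (Set.mem_insert _ _) x i).1 h2
      · simp only [Loose, not_or] at hv
        have h1 : ∀ l, leafPath (m := m) i l j = .inr (.inl j) := by
          intro l; simp [leafPath, branch, hv.1, hv.2]
        have h2 : ∀ l, leafPath (m := m) i l (Fin.last _) = .inr (.inr l) := by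
          intro l; simp [leafPath]
        rcases lt_or_gt_of_ne (π.injective.ne hv.2) with h3 | h3
        · right
          intro l
          have := (hleaf l _ _).2 h3
          rwa [h1, h2] at this
        · left
          intro l
          have := (hleaf l _ _).2 h3
          rwa [h1, h2] at this
      · exact absurd trivial hv
    let f : Fin m → Fin N := fun l => ℓ (.inr (.inr l))
    have hf : Function.Injective f := fun a b hab => by simpa [f] using hab
    simp only [T, Finset.mem_filter, Finset.mem_univ, true_and]
    rcases hside with h1 | h1
    · right
      have := Finset.card_le_card_of_injOn (s := Finset.univ) (t := Finset.Iio (ℓ v)) f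
        (fun l _ => by simpa using h1 l) hf.injOn
      simpa using this
    · left
      have := Finset.card_le_card_of_injOn (s := Finset.univ) (t := Finset.Ioi (ℓ v)) f
        (fun l _ => by simpa using h1 l) hf.injOn
      have h2 := (ℓ v).2
      simp at this h2
      omega
  refine (card_equiv_le_of_values _ (Loose π i) T hT).trans ?_
  refine Nat.mul_le_mul_right _ ?_
  exact (Nat.pow_le_pow_left hTcard _).trans (Nat.pow_le_pow_right (by omega) hB)

/-- A height function all of whose compatible labelings realize the pattern on the branch, and
realize it on the spine up to permuting the vertices below the `i`-th one. -/
def height (π : Pattern (κ + 2)) (i : Fin (κ + 2)) : TestVertex (κ + 2) m → ℕ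
  | .inl x => if π x < π i then π (Fin.last _) * (κ + 2) else π 0 * (κ + 2) + π x
  | .inr (.inl j) => if j = 0 ∨ j = Fin.last _ then π (Fin.last _) * (κ + 2) else π j * (κ + 2)
  | .inr (.inr _) => π (Fin.last _) * (κ + 2)

theorem height_of_loose (π : Pattern (κ + 2)) (i : Fin (κ + 2)) (v : TestVertex (κ + 2) m)
    (h : Loose π i v) : height π i v = π (Fin.last _) * (κ + 2) := by
  rcases v with x | j | l
  · exact if_pos h
  · exact if_pos h
  · rfl

theorem height_ofSubtype (π : Pattern (κ + 2)) (i : Fin (κ + 2))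
    (h : Equiv.Perm {v : TestVertex (κ + 2) m // Loose π i v}) (v : TestVertex (κ + 2) m) :
    height π i (Equiv.Perm.ofSubtype h v) = height π i v := by
  by_cases hv : Loose π i v
  · rw [Equiv.Perm.ofSubtype_apply_of_mem _ hv, height_of_loose π i v hv,
      height_of_loose π i _ (h ⟨v, hv⟩).2]
  · rw [Equiv.Perm.ofSubtype_apply_of_not_mem _ hv]

theorem height_leafPath_lt (π : Pattern (κ + 2)) (i : Fin (κ + 2))
    (l : Fin m) {x y : Fin (κ + 2)} (h : π x < π y) :
    height π i (leafPath i l x) < height π i (leafPath i l y) := by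
  have hval : ∀ z, π z * (κ + 2) ≤ height π i (leafPath i l z) ∧
      height π i (leafPath i l z) < (π z + 1) * (κ + 2) := by
    intro z
    by_cases hz : z = Fin.last _
    · subst hz
      simp [leafPath, height, add_mul]
    · by_cases hz0 : z = 0
      · subst hz0
        have := (π i).2
        simp [leafPath, height, branch, add_mul, hz]
      · simp [leafPath, height, branch, add_mul, hz, hz0]
  have h1 := Nat.mul_le_mul_right (κ + 2) (show (π x : ℕ) + 1 ≤ π y from h)
  exact (hval x).2.trans_le (h1.trans (hval y).1)

theorem factorial_le_card_forcedLabelings (π : Pattern (κ + 2)) (hπ : π (Fin.last _) < π 0)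
    (i : Fin (κ + 2)) :
    (Fintype.card {v : TestVertex (κ + 2) m // Loose π i v}).factorial ≤
      Nat.card (ForcedLabelings (paths (m := m) i) π) * (κ + 2).factorial := by
  obtain ⟨ℓ₀, hℓ₀⟩ := exists_equiv_fin_of_lt (height (m := m) π i)
  let ext : Equiv.Perm {x // π x < π i} → Equiv.Perm (TestVertex (κ + 2) m) := fun σ =>
    Equiv.sumCongr (Equiv.Perm.ofSubtype σ) (Equiv.refl _)
  refine (factorial_le_card_equiv_mul
    (fun ℓ => ∀ v ∈ paths i, ∀ x y, ℓ (v x) < ℓ (v y) ↔ π x < π y) (Loose π i) ℓ₀ ext ?_).trans ?_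
  · intro h
    let ℓ := (Equiv.Perm.ofSubtype h).trans ℓ₀
    have hℓ : ∀ a b, height π i a < height π i b → ℓ a < ℓ b := fun a b hab =>
      hℓ₀ _ _ (by rwa [height_ofSubtype, height_ofSubtype])
    obtain ⟨σ, hσ⟩ := exists_perm_lt_of_lt (X := {x // π x < π i})
      (fun x => (ℓ (.inl x.1) : ℕ)) (fun x => (π x.1 : ℕ))
      (fun a b hab => by simpa [Subtype.ext_iff, Fin.val_inj] using hab)
    refine ⟨σ, ?_⟩
    change ∀ v ∈ paths i, ∀ x y, ℓ (ext σ (v x)) < ℓ (ext σ (v y)) ↔ π x < π y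
    suffices hmono : ∀ v ∈ paths i, ∀ x y, π x < π y → ℓ (ext σ (v x)) < ℓ (ext σ (v y)) by
      intro v hv x y
      refine ⟨fun hlt => ?_, hmono v hv x y⟩
      by_contra hle
      rcases (not_lt.1 hle).lt_or_eq with h1 | h1
      · exact lt_asymm hlt (hmono v hv y x h1)
      · rw [π.injective h1] at hlt
        exact lt_irrefl _ hlt
    have hext : ∀ v, height π i (ext σ v) = height π i v := by
      rintro (x | w)
      · by_cases hx : π x < π i
        · have h1 : π (Equiv.Perm.ofSubtype σ x) < π i := by
            rw [Equiv.Perm.ofSubtype_apply_of_mem (p := fun x => π x < π i) σ hx]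
            exact (σ ⟨x, hx⟩).2
          simp [ext, height, hx, h1]
        · simp only [ext, Equiv.sumCongr_apply, Sum.map_inl,
            Equiv.Perm.ofSubtype_apply_of_not_mem (p := fun x => π x < π i) σ hx]
      · rfl
    rintro v (rfl | ⟨l, rfl⟩) x y hxy
    · by_cases hy : π y < π i
      · have hx := hxy.trans hy
        have := hσ ⟨x, hx⟩ ⟨y, hy⟩ hxy
        simpa only [ext, Equiv.sumCongr_apply, Sum.map_inl, Fin.val_fin_lt,
          Equiv.Perm.ofSubtype_apply_of_mem (p := fun x => π x < π i) σ hx,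
          Equiv.Perm.ofSubtype_apply_of_mem (p := fun x => π x < π i) σ hy] using this
      · refine hℓ _ _ ?_
        rw [hext, hext]
        have h1 := Nat.mul_lt_mul_of_pos_right (Fin.lt_def.1 hπ) (show 0 < κ + 2 by omega)
        have h2 := Fin.lt_def.1 hxy
        simp only [height, hy, if_false]
        split_ifs <;> omega
    · refine hℓ _ _ ?_
      rw [hext, hext]
      exact height_leafPath_lt π i l hxy
  · refine Nat.mul_le_mul_left _ (Nat.factorial_le ?_)
    simpa using Fintype.card_subtype_le fun x => π x < π i

end TestVertex

open TestVertex in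
theorem SuperStrongCEquiv.apply_le {κ : ℕ} {π π' : Pattern (κ + 2)}
    (h : SuperStrongCEquiv π π') (hπ : π (Fin.last _) < π 0) (hπ' : π' (Fin.last _) < π' 0)
    (i : Fin (κ + 2)) : π' i ≤ π i := by
  by_contra hlt
  rw [not_le] at hlt
  let C := (4 * (κ + 2)) ^ (2 * (κ + 2)) * (κ + 2).factorial
  have hcard := h.card_forcedLabelings (TestVertex.parent i) depth (depth_lt_of_parent i)
    (paths (m := C) i) (parent_of_mem_paths i)
  have hup := card_forcedLabelings_le (m := C) π hπ i
  have hlow := factorial_le_card_forcedLabelings (m := C) π' hπ' i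
  have hB := card_loose (m := C) π i
  have hB' := card_loose (m := C) π' i
  rw [← hcard] at hlow
  generalize Fintype.card {v // Loose (m := C) π i v} = b at *
  generalize Fintype.card {v // Loose (m := C) π' i v} = b' at *
  have hb : b + 1 ≤ b' := by
    have := Fin.lt_def.1 hlt
    omega
  have h1 : (b + 1).factorial ≤ C * b.factorial :=
    calc (b + 1).factorial ≤ b'.factorial := Nat.factorial_le hb
      _ ≤ _ := hlow
      _ ≤ _ := Nat.mul_le_mul_right _ hup
      _ = C * b.factorial := by simp only [C]; ring
  rw [Nat.factorial_succ] at h1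
  have := Nat.le_of_mul_le_mul_right h1 b.factorial_pos
  omega

theorem SuperStrongCEquiv.eq_of_last_lt {κ : ℕ} {π π' : Pattern (κ + 2)}
    (h : SuperStrongCEquiv π π') (hπ : π (Fin.last _) < π 0) (hπ' : π' (Fin.last _) < π' 0) :
    π' = π :=
  Equiv.ext fun i => le_antisymm (h.apply_le hπ hπ' i) (h.symm.apply_le hπ' hπ i)


/-- Super-strong c-forest-Wilf equivalences are trivial: `π' = π` or `π'` is the
complement of `π`. -/
theorem superStrongCEquiv_trivial {k : ℕ} (π π' : Pattern k)
    (h : SuperStrongCEquiv π π') : π' = π ∨ π' = Pattern.compl π := by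
  rcases k with _ | _ | κ
  · exact .inl (Subsingleton.elim _ _)
  · exact .inl (Equiv.ext fun _ => Subsingleton.elim (α := Fin 1) _ _)
  · have hne : (Fin.last (κ + 1)) ≠ 0 := Fin.last_pos.ne'
    have hcompl : ∀ ρ : Pattern (κ + 2), ¬ ρ (Fin.last _) < ρ 0 →
        ρ.compl (Fin.last _) < ρ.compl 0 := fun ρ hρ =>
      Fin.rev_lt_rev.2 (lt_of_le_of_ne (not_lt.1 hρ) (ρ.injective.ne hne.symm))
    by_cases hπ : π (Fin.last _) < π 0 <;> by_cases hπ' : π' (Fin.last _) < π' 0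
    · exact .inl (h.eq_of_last_lt hπ hπ')
    · right
      have := h.symm.compl_left.symm.eq_of_last_lt hπ (hcompl _ hπ')
      rw [← this, Pattern.compl_compl]
    · exact .inr (h.compl_left.eq_of_last_lt (hcompl _ hπ) hπ')
    · left
      have := h.compl_left.symm.compl_left.symm.eq_of_last_lt (hcompl _ hπ) (hcompl _ hπ')
      rw [← Pattern.compl_compl π', this, Pattern.compl_compl]
end

section
/- Let S be a set of patterns such that either no pattern in S begins with 1, or no pattern in S begins with its largest element (i.e., no π ∈ S of length k has π(1) = k). Then the limits lim_{n→∞} f_n(S)^{1/n}/n and lim_{n→∞} t_n(S)^{1/n}/n both exist as finite real numbers and are equal. -/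
/-! ### Growth of sequences with `F' ≥ F ^ 2` -/

section Growth

open Filter Topology Finset

theorem tendsto_log_natCast_div_atTop :
    Tendsto (fun n : ℕ => Real.log n / n) atTop (𝓝 0) :=
  (Real.isLittleO_log_id_atTop.tendsto_div_nhds_zero).comp tendsto_natCast_atTop_atTop

theorem tendsto_log_factorial_div_sub_log :
    Tendsto (fun n : ℕ => Real.log (n.factorial : ℝ) / n - Real.log n) atTop (𝓝 (-1)) := by
  have hs : Tendsto (fun n : ℕ => Real.log (Stirling.stirlingSeq n) / n) atTop (𝓝 0) :=
    (Stirling.tendsto_stirlingSeq_sqrt_pi.log (by positivity)).div_atTop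
      tendsto_natCast_atTop_atTop
  have h2 : Tendsto (fun n : ℕ => Real.log 2 / n) atTop (𝓝 0) :=
    tendsto_const_nhds.div_atTop tendsto_natCast_atTop_atTop
  have h := ((hs.add ((h2.add tendsto_log_natCast_div_atTop).const_mul (1 / 2))).sub_const 1)
  refine (h.congr' ?_).trans (by norm_num)
  filter_upwards [eventually_ge_atTop 1] with n hn
  have hn' : (0 : ℝ) < n := by exact_mod_cast hn
  rw [Stirling.log_stirlingSeq_formula, Real.log_mul (by norm_num) hn'.ne',
    Real.log_div hn'.ne' (Real.exp_pos 1).ne', Real.log_exp]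
  field_simp
  ring

/-- If `log (u n / n!) / n` converges to `l`, then `u n ^ (1 / n) / n` converges to
`exp (l - 1)`. -/
theorem tendsto_root_div_of_tendsto_log_div {u : ℕ → ℝ} {l : ℝ} (hu : ∀ n, 1 ≤ n → 0 < u n)
    (h : Tendsto (fun n : ℕ => Real.log (u n / n.factorial) / n) atTop (𝓝 l)) :
    Tendsto (fun n : ℕ => u n ^ ((n : ℝ)⁻¹) / n) atTop (𝓝 (Real.exp (l - 1))) := by
  have h' := (Real.continuous_exp.tendsto _).comp (h.add tendsto_log_factorial_div_sub_log)
  refine h'.congr' ?_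
  filter_upwards [eventually_ge_atTop 1] with n hn
  have hn' : (0 : ℝ) < n := by exact_mod_cast hn
  have hf : (0 : ℝ) < n.factorial := by positivity
  rw [Function.comp_apply, Real.rpow_def_of_pos (hu n hn), Real.log_div (hu n hn).ne' hf.ne',
    sub_div, sub_add_sub_cancel, Real.exp_sub, Real.exp_log hn', div_eq_mul_inv (Real.log _)]

variable {c : ℕ → ℝ}

theorem geometric_le_of_convolution_le (hc : ∀ n, 0 ≤ c n)
    (hconv : ∀ n : ℕ, ∑ p ∈ antidiagonal n, c p.1 * c p.2 ≤ (n + 1) * c (n + 1)) (M J : ℕ) :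
    c M * (c M / (2 * (M + 1))) ^ J ≤ c ((M + 1) * J + M) := by
  induction J using Nat.strong_induction_on with
  | _ J ih =>
    rcases J with _ | J
    · simp
    · set r : ℝ := c M / (2 * (M + 1)) with hr
      have hr0 : 0 ≤ r := div_nonneg (hc M) (by positivity)
      have hsum : ∑ p ∈ antidiagonal J, c ((M + 1) * p.1 + M) * c ((M + 1) * p.2 + M) ≤
          ∑ p ∈ antidiagonal ((M + 1) * J + 2 * M), c p.1 * c p.2 := by
        have hinj : Set.InjOn (fun p : ℕ × ℕ => ((M + 1) * p.1 + M, (M + 1) * p.2 + M))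
            (antidiagonal J) := by
          intro p _ q _ hpq
          simp only [Prod.mk.injEq, Nat.add_right_cancel_iff] at hpq
          exact Prod.ext (Nat.eq_of_mul_eq_mul_left M.succ_pos hpq.1)
            (Nat.eq_of_mul_eq_mul_left M.succ_pos hpq.2)
        rw [← sum_image (f := fun p : ℕ × ℕ => c p.1 * c p.2) hinj]
        refine sum_le_sum_of_subset_of_nonneg ?_ fun p _ _ => mul_nonneg (hc _) (hc _)
        intro p hp
        obtain ⟨q, hq, rfl⟩ := mem_image.1 hp
        rw [HasAntidiagonal.mem_antidiagonal] at hq ⊢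
        simp only [← hq]
        ring
      have hterm : ∀ p ∈ antidiagonal J, c M ^ 2 * r ^ J ≤
          c ((M + 1) * p.1 + M) * c ((M + 1) * p.2 + M) := by
        intro p hp
        rw [HasAntidiagonal.mem_antidiagonal] at hp
        calc c M ^ 2 * r ^ J = (c M * r ^ p.1) * (c M * r ^ p.2) := by rw [← hp]; ring
          _ ≤ _ := mul_le_mul (ih _ (by omega)) (ih _ (by omega))
            (mul_nonneg (hc _) (pow_nonneg hr0 _)) (hc _)
      have hlow := (card_nsmul_le_sum _ _ _ hterm).trans (hsum.trans (hconv _))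
      rw [Nat.card_antidiagonal, nsmul_eq_mul] at hlow
      have hidx : (M + 1) * J + 2 * M + 1 = (M + 1) * (J + 1) + M := by ring
      rw [hidx] at hlow
      have hpos : (0 : ℝ) < 2 * (M + 1) * (J + 1) := by positivity
      have hle : ((((M + 1) * J + 2 * M : ℕ) : ℝ) + 1) ≤ 2 * (M + 1) * (J + 1) := by
        push_cast
        have : (0 : ℝ) ≤ M * J := by positivity
        have : (0 : ℝ) ≤ J := by positivity
        nlinarith
      have hlow' := hlow.trans (mul_le_mul_of_nonneg_right hle (hc _))
      refine le_of_mul_le_mul_left (le_trans (le_of_eq ?_) hlow') hpos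
      have hcr : c M = r * (2 * (M + 1)) := by rw [hr]; field_simp
      rw [hcr]
      push_cast
      ring

theorem le_pow_mul_of_convolution_le (h0 : 1 ≤ c 0) (hc : ∀ n, 0 ≤ c n)
    (hconv : ∀ n : ℕ, ∑ p ∈ antidiagonal n, c p.1 * c p.2 ≤ (n + 1) * c (n + 1)) (n s : ℕ) :
    c n ≤ (n + s : ℝ) ^ s * c (n + s) := by
  induction s with
  | zero => simp
  | succ s ih =>
    have h1 : c (n + s) ≤ (n + s + 1 : ℝ) * c (n + s + 1) := by
      have h2 := single_le_sum (f := fun p : ℕ × ℕ => c p.1 * c p.2)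
        (fun p _ => mul_nonneg (hc p.1) (hc p.2))
        (show (n + s, 0) ∈ antidiagonal (n + s) by simp)
      have h3 := h2.trans (hconv (n + s))
      push_cast at h3
      nlinarith [hc (n + s)]
    calc c n ≤ (n + s : ℝ) ^ s * c (n + s) := ih
      _ ≤ (n + s + 1 : ℝ) ^ s * ((n + s + 1 : ℝ) * c (n + s + 1)) := by
          refine mul_le_mul (pow_le_pow_left₀ (by positivity) (by linarith) s) h1 (hc _)
            (by positivity)
      _ = _ := by push_cast; rw [← add_assoc n s 1]; ring

theorem log_lower_bound_of_convolution_le (h0 : 1 ≤ c 0) (hc : ∀ n, 0 < c n)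
    (hconv : ∀ n : ℕ, ∑ p ∈ antidiagonal n, c p.1 * c p.2 ≤ (n + 1) * c (n + 1)) {M n : ℕ}
    (hn : M ≤ n) :
    (((n + 1) / (M + 1) : ℕ) : ℝ) * Real.log (c M / (2 * (M + 1))) - M * Real.log (n + 1) ≤
      Real.log (c n) := by
  obtain ⟨J, hJ⟩ : ∃ J, (n + 1) / (M + 1) = J + 1 :=
    ⟨(n + 1) / (M + 1) - 1, by have := Nat.div_pos (show M + 1 ≤ n + 1 by omega) M.succ_pos; omega⟩
  set s := (n + 1) % (M + 1) with hs
  have hsM : s ≤ M := Nat.lt_succ_iff.1 (Nat.mod_lt _ M.succ_pos)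
  have hdecomp : n = (M + 1) * J + M + s := by
    have := Nat.div_add_mod (n + 1) (M + 1)
    rw [hJ, ← hs] at this
    linarith [this, mul_add (M + 1) J 1]
  have hx := hc M
  set r : ℝ := c M / (2 * (M + 1)) with hr
  have hr0 : 0 < r := by positivity
  have hrx : r ≤ c M := div_le_self hx.le (by have : (0 : ℝ) ≤ M := by positivity
                                              linarith)
  have hn1 : (1 : ℝ) ≤ n + 1 := by have : (0 : ℝ) ≤ n := by positivity
                                   linarith
  have h1 : r ^ (J + 1) ≤ (n + 1 : ℝ) ^ M * c n := by
    calc r ^ (J + 1) = r * r ^ J := by ring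
      _ ≤ c M * r ^ J := by gcongr
      _ ≤ c ((M + 1) * J + M) := geometric_le_of_convolution_le (fun n => (hc n).le) hconv M J
      _ ≤ _ := le_pow_mul_of_convolution_le h0 (fun n => (hc n).le) hconv _ s
      _ ≤ (n + 1 : ℝ) ^ M * c n := by
          rw [← hdecomp]
          have e : (((M + 1) * J + M : ℕ) : ℝ) + s = n := by exact_mod_cast hdecomp.symm
          rw [e]
          refine mul_le_mul_of_nonneg_right ?_ (hc n).le
          calc (n : ℝ) ^ s ≤ (n + 1 : ℝ) ^ s := by gcongr; linarith
            _ ≤ _ := pow_le_pow_right₀ hn1 hsM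
  have h2 := Real.log_le_log (by positivity) h1
  rw [Real.log_mul (by positivity) (hc n).ne', Real.log_pow, Real.log_pow] at h2
  rw [hJ]
  linarith

/-- A Fekete-type lemma: a sequence of positive reals whose generating function satisfies
`F' ≥ F ^ 2` coefficientwise and which grows at most exponentially has an exponential growth
rate. -/
theorem exists_tendsto_log_div_of_convolution_le (h0 : 1 ≤ c 0) (hc : ∀ n, 0 < c n)
    (hconv : ∀ n : ℕ, ∑ p ∈ antidiagonal n, c p.1 * c p.2 ≤ (n + 1) * c (n + 1))
    (hub : ∀ n : ℕ, c n ≤ Real.exp (n + 1)) :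
    ∃ l : ℝ, Tendsto (fun n : ℕ => Real.log (c n) / (n + 1)) atTop (𝓝 l) := by
  set w : ℕ → ℝ := fun M => Real.log (c M / (2 * (M + 1))) / (M + 1) with hw
  have hwlog : ∀ M : ℕ, Real.log (c M) / (M + 1) =
      w M + (Real.log 2 / ((M + 1 : ℕ) : ℝ) + Real.log ((M + 1 : ℕ) : ℝ) / ((M + 1 : ℕ) : ℝ)) := by
    intro M
    have hM : (0 : ℝ) < M + 1 := by positivity
    simp only [hw]
    rw [Real.log_div (hc M).ne' (by positivity), Real.log_mul (by norm_num) hM.ne']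
    push_cast
    field_simp
    ring
  have hbdd : BddAbove (Set.range w) := by
    refine ⟨1, ?_⟩
    rintro _ ⟨M, rfl⟩
    have hM : (0 : ℝ) < M + 1 := by positivity
    simp only [hw]
    rw [div_le_one hM, Real.log_le_iff_le_exp (div_pos (hc M) (by positivity))]
    exact (div_le_self (hc M).le (by have : (0 : ℝ) ≤ M := by positivity
                                     linarith)).trans (hub M)
  have hlog := (tendsto_add_atTop_iff_nat 1).2 tendsto_log_natCast_div_atTop
  have hconst : ∀ a : ℝ, Tendsto (fun n : ℕ => a / ((n + 1 : ℕ) : ℝ)) atTop (𝓝 0) := fun a =>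
    tendsto_const_nhds.div_atTop
      (tendsto_natCast_atTop_atTop.comp (tendsto_add_atTop_nat 1))
  refine ⟨⨆ M, w M, tendsto_order.2 ⟨fun a ha => ?_, fun a ha => ?_⟩⟩
  · obtain ⟨M, hM⟩ := exists_lt_of_lt_ciSup ha
    have hM0 : (0 : ℝ) < M + 1 := by positivity
    have hfl : Tendsto (fun n : ℕ => (((n + 1) / (M + 1) : ℕ) : ℝ) / ((n + 1 : ℕ) : ℝ)) atTop
        (𝓝 ((M + 1 : ℝ)⁻¹)) := by
      have h1 := (tendsto_nat_floor_mul_div_atTop (R := ℝ) (a := (M + 1 : ℝ)⁻¹)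
        (by positivity)).comp
        (tendsto_natCast_atTop_atTop.comp (tendsto_add_atTop_nat 1))
      refine h1.congr fun n => ?_
      simp only [Function.comp_apply]
      congr 2
      rw [inv_mul_eq_div]
      exact_mod_cast Nat.floor_div_eq_div (K := ℝ) (n + 1) (M + 1)
    have hlim := (hfl.mul_const (Real.log (c M / (2 * (M + 1))))).sub (hlog.const_mul (M : ℝ))
    rw [mul_zero, sub_zero, inv_mul_eq_div] at hlim
    filter_upwards [hlim.eventually (lt_mem_nhds hM), eventually_ge_atTop M] with n h1 h2
    refine h1.trans_le ?_
    have h3 := log_lower_bound_of_convolution_le h0 hc hconv h2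
    have hn0 : (0 : ℝ) < n + 1 := by positivity
    rw [le_div_iff₀ hn0]
    refine le_trans (le_of_eq ?_) h3
    push_cast
    field_simp
  · have hlim := ((hconst (Real.log 2)).add hlog).const_add (⨆ M, w M)
    rw [add_zero, add_zero] at hlim
    filter_upwards [hlim.eventually (gt_mem_nhds ha)] with n h1
    rw [hwlog n]
    refine lt_of_le_of_lt ?_ h1
    gcongr
    exact le_ciSup hbdd n

end Growth

/-! ### Gluing two forests below and beside a new smallest root -/

namespace RForest

variable {n a b : ℕ}

theorem ext_parent {F G : RForest n} (h : F.parent = G.parent) : F = G := by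
  cases F; cases G; cases h; rfl

instance : Finite (RForest n) :=
  Finite.of_injective RForest.parent fun _ _ => ext_parent

theorem natCard_le (n : ℕ) : Nat.card (RForest n) ≤ (n + 1) ^ n := by
  refine (Nat.card_le_card_of_injective RForest.parent fun _ _ => ext_parent).trans (le_of_eq ?_)
  simp

theorem wellFounded_sAnc (F : RForest n) : WellFounded F.SAnc :=
  haveI : IsTrans (Fin n) F.SAnc := ⟨fun _ _ _ => Relation.TransGen.trans⟩
  haveI : Std.Irrefl F.SAnc := ⟨F.acyclic⟩
  Finite.wellFounded_of_trans_of_irrefl _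

/-- The parent function obtained from `F` and `G`, whose vertices are identified with
complementary subsets of `Fin n` through `σ`, by adding a new smallest vertex that becomes a root
and the parent of the roots of `F`. -/
def glueParent (σ : Fin a ⊕ Fin b ≃ Fin n) (F : RForest a) (G : RForest b) :
    Fin (n + 1) → Option (Fin (n + 1)) :=
  Fin.cases none fun i => match σ.symm i with
    | .inl j => some ((F.parent j).elim 0 fun k => (σ (.inl k)).succ)
    | .inr j => (G.parent j).map fun k => (σ (.inr k)).succ

section Glue

variable (σ : Fin a ⊕ Fin b ≃ Fin n) (F : RForest a) (G : RForest b)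

@[simp] theorem glueParent_zero : glueParent σ F G 0 = none := rfl

@[simp] theorem glueParent_inl (j : Fin a) : glueParent σ F G (σ (.inl j)).succ =
    some ((F.parent j).elim 0 fun k => (σ (.inl k)).succ) := by
  simp [glueParent]

@[simp] theorem glueParent_inr (j : Fin b) : glueParent σ F G (σ (.inr j)).succ =
    (G.parent j).map fun k => (σ (.inr k)).succ := by
  simp [glueParent]

theorem transGen_glueParent {u v : Fin (n + 1)}
    (h : Relation.TransGen (fun x y => glueParent σ F G y = some x) u v) :
    (∃ j, v = (σ (.inl j)).succ ∧ (u = 0 ∨ ∃ i, u = (σ (.inl i)).succ ∧ F.SAnc i j)) ∨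
      ∃ j, v = (σ (.inr j)).succ ∧ ∃ i, u = (σ (.inr i)).succ ∧ G.SAnc i j := by
  have base : ∀ {x y : Fin (n + 1)}, glueParent σ F G y = some x →
      (∃ j, y = (σ (.inl j)).succ ∧ (x = 0 ∨ ∃ i, x = (σ (.inl i)).succ ∧ F.parent j = some i)) ∨
      ∃ j, y = (σ (.inr j)).succ ∧ ∃ i, x = (σ (.inr i)).succ ∧ G.parent j = some i := by
    intro x y hxy
    induction y using Fin.cases with
    | zero => simp at hxy
    | succ y =>
      obtain ⟨j | j, rfl⟩ := σ.surjective y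
      · left
        refine ⟨j, rfl, ?_⟩
        rw [glueParent_inl] at hxy
        cases hj : F.parent j with
        | none => left; simpa [hj] using hxy.symm
        | some k => right; exact ⟨k, by simpa [hj] using hxy.symm, rfl⟩
      · right
        refine ⟨j, rfl, ?_⟩
        rw [glueParent_inr] at hxy
        obtain ⟨k, hk, rfl⟩ := Option.map_eq_some_iff.1 hxy
        exact ⟨k, rfl, hk⟩
  induction h with
  | single h =>
    rcases base h with ⟨j, rfl, rfl | ⟨i, rfl, hi⟩⟩ | ⟨j, rfl, i, rfl, hi⟩
    · exact .inl ⟨j, rfl, .inl rfl⟩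
    · exact .inl ⟨j, rfl, .inr ⟨i, rfl, .single hi⟩⟩
    · exact .inr ⟨j, rfl, i, rfl, .single hi⟩
  | tail _ h ih =>
    rcases base h with ⟨j, rfl, rfl | ⟨i, rfl, hi⟩⟩ | ⟨j, rfl, i, rfl, hi⟩
    · rcases ih with ⟨j', h', _⟩ | ⟨j', h', _⟩ <;> exact absurd h'.symm (Fin.succ_ne_zero _)
    · rcases ih with ⟨j', h', hu⟩ | ⟨j', h', _⟩
      · obtain rfl : i = j' := by simpa using h'
        refine .inl ⟨j, rfl, hu.imp_right ?_⟩
        rintro ⟨i', rfl, hi'⟩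
        exact ⟨i', rfl, hi'.tail hi⟩
      · simp at h'
    · rcases ih with ⟨j', h', _⟩ | ⟨j', h', i', rfl, hi'⟩
      · simp at h'
      · obtain rfl : i = j' := by simpa using h'
        exact .inr ⟨j, rfl, i', rfl, hi'.tail hi⟩

/-- The forest obtained from `F` and `G` by adding a new smallest vertex that becomes a root and
the parent of the roots of `F`. -/
def glue : RForest (n + 1) where
  parent := glueParent σ F G
  acyclic v hv := by
    rcases transGen_glueParent σ F G hv with ⟨j, rfl, h | ⟨i, hi, h⟩⟩ | ⟨j, rfl, i, hi, h⟩
    · exact Fin.succ_ne_zero _ h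
    · obtain rfl : j = i := by simpa using hi
      exact F.acyclic _ h
    · obtain rfl : j = i := by simpa using hi
      exact G.acyclic _ h

theorem glue_sAnc_zero_inl (j : Fin a) : (glue σ F G).SAnc 0 (σ (.inl j)).succ := by
  induction j using F.wellFounded_sAnc.induction with
  | _ j ih =>
    have hj := glueParent_inl σ F G j
    cases hp : F.parent j with
    | none =>
      rw [hp] at hj
      exact .single hj
    | some k =>
      rw [hp] at hj
      exact .tail (ih k (.single hp)) hj

theorem not_glue_sAnc_zero_inr (j : Fin b) : ¬ (glue σ F G).SAnc 0 (σ (.inr j)).succ := by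
  intro h
  rcases transGen_glueParent σ F G h with ⟨j', h', _⟩ | ⟨j', _, i, h', _⟩
  · simp at h'
  · exact Fin.succ_ne_zero _ h'.symm

theorem avoidsSet_glue {S : Set ((k : ℕ) × Pattern k)}
    (h : ∀ p ∈ S, ∀ h0 : 0 < p.1, (p.2 ⟨0, h0⟩ : ℕ) ≠ 0)
    (hl : StrictMono fun i => σ (.inl i)) (hr : StrictMono fun i => σ (.inr i))
    (hF : AvoidsSet F S) (hG : AvoidsSet G S) : AvoidsSet (glue σ F G) S := by
  rintro ⟨k, π⟩ hp ⟨v, hv, hlt⟩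
  rcases k with _ | k
  · exact hF _ hp ⟨fun i => i.elim0, fun i => i.elim0, fun i => i.elim0⟩
  have hv0 : v 0 ≠ 0 := by
    intro h0
    have h1 := (hlt (π.symm 0) 0).2 (by
      rw [Equiv.apply_symm_apply]
      exact Fin.pos_iff_ne_zero.2 fun h2 => h _ hp k.succ_pos (congrArg Fin.val h2))
    rw [h0] at h1
    exact absurd h1 (Fin.not_lt_zero _)
  have hne : ∀ i, v i ≠ 0 := by
    intro i hi
    rcases Fin.eq_zero_or_eq_succ i with rfl | ⟨i, rfl⟩
    · exact hv0 hi
    · rcases transGen_glueParent σ F G (hv 0 i.succ (Fin.succ_pos i)) with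
        ⟨j, h', _⟩ | ⟨j, h', _⟩ <;> exact Fin.succ_ne_zero _ (h'.symm.trans hi)
  obtain ⟨l, hlast⟩ := Fin.exists_succ_eq_of_ne_zero (hne (Fin.last k))
  obtain ⟨j | j, rfl⟩ := σ.surjective l
  · have hw : ∀ i, ∃ w, v i = (σ (.inl w)).succ := by
      intro i
      rcases (Fin.le_last i).eq_or_lt with rfl | hi
      · exact ⟨j, hlast.symm⟩
      · rcases transGen_glueParent σ F G (hv i _ hi) with
          ⟨j', _, h' | ⟨w, hw, _⟩⟩ | ⟨j', h', _⟩
        · exact absurd h' (hne i)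
        · exact ⟨w, hw⟩
        · simp [← hlast] at h'
    choose w hw using hw
    refine hF _ hp ⟨w, fun i i' hi => ?_, fun i i' => ?_⟩
    · rcases transGen_glueParent σ F G (hv i i' hi) with
        ⟨j', h1, h' | ⟨w', h2, h3⟩⟩ | ⟨j', h', _⟩
      · exact absurd h' (hne i)
      · obtain rfl : w i' = j' := by simpa [hw] using h1
        obtain rfl : w i = w' := by simpa [hw] using h2
        exact h3
      · simp [hw] at h'
    · rw [← hlt, hw, hw, Fin.succ_lt_succ_iff]
      exact hl.lt_iff_lt.symm
  · have hw : ∀ i, ∃ w, v i = (σ (.inr w)).succ := by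
      intro i
      rcases (Fin.le_last i).eq_or_lt with rfl | hi
      · exact ⟨j, hlast.symm⟩
      · rcases transGen_glueParent σ F G (hv i _ hi) with
          ⟨j', h', _⟩ | ⟨j', _, w, hw, _⟩
        · simp [← hlast] at h'
        · exact ⟨w, hw⟩
    choose w hw using hw
    refine hG _ hp ⟨w, fun i i' hi => ?_, fun i i' => ?_⟩
    · rcases transGen_glueParent σ F G (hv i i' hi) with
        ⟨j', h', _⟩ | ⟨j', h1, w', h2, h3⟩
      · simp [hw] at h'
      · obtain rfl : w i' = j' := by simpa [hw] using h1
        obtain rfl : w i = w' := by simpa [hw] using h2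
        exact h3
    · rw [← hlt, hw, hw, Fin.succ_lt_succ_iff]
      exact hr.lt_iff_lt.symm

variable {F G}

theorem glue_injective {F' : RForest a} {G' : RForest b} (h : glue σ F G = glue σ F' G') :
    F = F' ∧ G = G' := by
  have hp : glueParent σ F G = glueParent σ F' G' := congrArg RForest.parent h
  constructor
  · refine ext_parent (funext fun j => ?_)
    have := congrFun hp (σ (.inl j)).succ
    rw [glueParent_inl, glueParent_inl] at this
    cases h1 : F.parent j <;> cases h2 : F'.parent j <;> simp_all
    exact Fin.succ_ne_zero _ this.symm
  · refine ext_parent (funext fun j => ?_)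
    have := congrFun hp (σ (.inr j)).succ
    rw [glueParent_inr, glueParent_inr] at this
    refine Option.map_injective (fun x y hxy => ?_) this
    simpa using hxy

end Glue

/-- Reversing the order of the labels of a forest. -/
def compl (F : RForest n) : RForest n where
  parent v := (F.parent v.rev).map Fin.rev
  acyclic v hv := F.acyclic v.rev <| Relation.TransGen.lift Fin.rev (fun x y hxy => by
    obtain ⟨z, hz, rfl⟩ := Option.map_eq_some_iff.1 hxy
    simpa [Function.onFun] using hz) _ _ hv

theorem compl_compl (F : RForest n) : F.compl.compl = F :=
  ext_parent <| funext fun v => by simp [compl, Function.comp_def]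

theorem SAnc.compl {F : RForest n} {u v : Fin n} (h : F.SAnc u v) :
    F.compl.SAnc u.rev v.rev :=
  Relation.TransGen.lift Fin.rev (fun x y hxy => by simp [Function.onFun, RForest.compl, hxy]) _ _ h

theorem isTree_compl {F : RForest n} (h : F.IsTree) : F.compl.IsTree := by
  obtain ⟨r, hr, hu⟩ := h
  refine ⟨r.rev, by simpa [compl] using hr, fun y hy => ?_⟩
  rw [← hu y.rev (by simpa [compl] using hy), Fin.rev_rev]

theorem containsPat_compl {k : ℕ} {F : RForest n} {π : Pattern k} (h : ContainsPat F π) :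
    ContainsPat F.compl π.compl := by
  obtain ⟨v, hv, hlt⟩ := h
  refine ⟨fun i => (v i).rev, fun i j hij => (hv i j hij).compl, fun i j => ?_⟩
  rw [Fin.rev_lt_rev, hlt]
  exact Fin.rev_lt_rev.symm

end RForest

/-- The set of complements of the patterns in a set. -/
def complPatterns (S : Set ((k : ℕ) × Pattern k)) : Set ((k : ℕ) × Pattern k) :=
  {p | ⟨p.1, p.2.compl⟩ ∈ S}

theorem complPatterns_complPatterns (S : Set ((k : ℕ) × Pattern k)) :
    complPatterns (complPatterns S) = S := by
  ext ⟨k, π⟩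
  simp [complPatterns, Pattern.compl_compl]

theorem avoidsSet_compl {n : ℕ} {F : RForest n} {S : Set ((k : ℕ) × Pattern k)}
    (h : AvoidsSet F S) : AvoidsSet F.compl (complPatterns S) := by
  intro p hp hc
  have := RForest.containsPat_compl hc
  rw [RForest.compl_compl] at this
  exact h _ hp this

theorem RForest.compl_injective {n : ℕ} : Function.Injective (RForest.compl (n := n)) :=
  Function.LeftInverse.injective RForest.compl_compl

theorem fCount_le_fCount_complPatterns (S : Set ((k : ℕ) × Pattern k)) (n : ℕ) :
    fCount S n ≤ fCount (complPatterns S) n :=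
  Nat.card_le_card_of_injective
    (fun F => (⟨F.1.compl, avoidsSet_compl F.2⟩ : {F : RForest n // AvoidsSet F (complPatterns S)}))
    fun _ _ h => Subtype.ext (RForest.compl_injective (congrArg Subtype.val h))

theorem tCount_le_tCount_complPatterns (S : Set ((k : ℕ) × Pattern k)) (n : ℕ) :
    tCount S n ≤ tCount (complPatterns S) n :=
  Nat.card_le_card_of_injective
    (fun F => (⟨F.1.compl, RForest.isTree_compl F.2.1, avoidsSet_compl F.2.2⟩ :
      {F : RForest n // F.IsTree ∧ AvoidsSet F (complPatterns S)}))
    fun _ _ h => Subtype.ext (RForest.compl_injective (congrArg Subtype.val h))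

theorem fCount_complPatterns (S : Set ((k : ℕ) × Pattern k)) :
    fCount (complPatterns S) = fCount S :=
  funext fun n => le_antisymm
    (by simpa only [complPatterns_complPatterns] using
      fCount_le_fCount_complPatterns (complPatterns S) n)
    (fCount_le_fCount_complPatterns S n)

theorem tCount_complPatterns (S : Set ((k : ℕ) × Pattern k)) :
    tCount (complPatterns S) = tCount S :=
  funext fun n => le_antisymm
    (by simpa only [complPatterns_complPatterns] using
      tCount_le_tCount_complPatterns (complPatterns S) n)
    (tCount_le_tCount_complPatterns S n)

/-! ### Inequalities between the counts -/

section Counts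

variable {S : Set ((k : ℕ) × Pattern k)}

theorem fCount_le_pow (S : Set ((k : ℕ) × Pattern k)) (n : ℕ) : fCount S n ≤ (n + 1) ^ n :=
  (Nat.card_le_card_of_injective _ Subtype.val_injective).trans (RForest.natCard_le n)

theorem tCount_le_fCount (S : Set ((k : ℕ) × Pattern k)) (n : ℕ) : tCount S n ≤ fCount S n :=
  Nat.card_le_card_of_injective
    (fun F => (⟨F.1, F.2.2⟩ : {F : RForest n // AvoidsSet F S}))
    fun _ _ h => Subtype.ext (Subtype.mk.inj h)

/-- The empty forest. -/
def RForest.empty : RForest 0 := ⟨fun v => v.elim0, fun v => v.elim0⟩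

theorem avoidsSet_of_pos (hpos : ∀ p ∈ S, 0 < p.1) (F : RForest 0) : AvoidsSet F S :=
  fun p hp ⟨v, _⟩ => (v ⟨0, hpos p hp⟩).elim0

theorem one_le_fCount_zero (hpos : ∀ p ∈ S, 0 < p.1) : 1 ≤ fCount S 0 :=
  haveI : Nonempty {F : RForest 0 // AvoidsSet F S} := ⟨⟨.empty, avoidsSet_of_pos hpos _⟩⟩
  Nat.card_pos

theorem fCount_le_tCount_succ (hpos : ∀ p ∈ S, 0 < p.1)
    (h : ∀ p ∈ S, ∀ h0 : 0 < p.1, (p.2 ⟨0, h0⟩ : ℕ) ≠ 0) (n : ℕ) :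
    fCount S n ≤ tCount S (n + 1) := by
  let σ : Fin n ⊕ Fin 0 ≃ Fin n := Equiv.sumEmpty _ _
  refine Nat.card_le_card_of_injective
    (fun F => (⟨RForest.glue σ F.1 .empty, ⟨0, rfl, ?_⟩,
      RForest.avoidsSet_glue σ _ _ h (fun _ _ hij => hij) (fun i => i.elim0) F.2
        (avoidsSet_of_pos hpos _)⟩ : {F : RForest (n + 1) // F.IsTree ∧ AvoidsSet F S}))
    fun _ _ hF => Subtype.ext (RForest.glue_injective σ (congrArg Subtype.val hF)).1
  intro y hy
  induction y using Fin.cases with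
  | zero => rfl
  | succ y =>
    have := RForest.glueParent_inl σ F.1 .empty y
    rw [show (σ (.inl y)).succ = y.succ from rfl] at this
    exact absurd (hy.symm.trans this) (by simp)

theorem sum_choose_mul_fCount_le
    (h : ∀ p ∈ S, ∀ h0 : 0 < p.1, (p.2 ⟨0, h0⟩ : ℕ) ≠ 0) (n : ℕ) :
    ∑ k ∈ Finset.range (n + 1), n.choose k * (fCount S k * fCount S (n - k)) ≤
      fCount S (n + 1) := by
  have hcompl : ∀ A : Finset (Fin n), Aᶜ.card = n - A.card := fun A => by
    rw [Finset.card_compl, Fintype.card_fin]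
  let σ : (A : Finset (Fin n)) → Fin A.card ⊕ Fin (n - A.card) ≃ Fin n := fun A =>
    finSumEquivOfFinset rfl (hcompl A)
  let Φ : (Σ A : Finset (Fin n), {F : RForest A.card // AvoidsSet F S} ×
      {F : RForest (n - A.card) // AvoidsSet F S}) →
      {F : RForest (n + 1) // AvoidsSet F S} := fun x =>
    ⟨RForest.glue (σ x.1) x.2.1.1 x.2.2.1, RForest.avoidsSet_glue _ _ _ h
      (Finset.orderEmbOfFin x.1 rfl).strictMono
      (Finset.orderEmbOfFin x.1ᶜ (hcompl x.1)).strictMono x.2.1.2 x.2.2.2⟩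
  have hmem : ∀ (A : Finset (Fin n)) (F : RForest A.card) (G : RForest (n - A.card)) (i : Fin n),
      i ∈ A ↔ (RForest.glue (σ A) F G).SAnc 0 i.succ := by
    intro A F G i
    obtain ⟨j | j, rfl⟩ := (σ A).surjective i
    · exact iff_of_true (Finset.orderEmbOfFin_mem A rfl j) (RForest.glue_sAnc_zero_inl _ F G j)
    · exact iff_of_false (Finset.mem_compl.1 (Finset.orderEmbOfFin_mem Aᶜ (hcompl A) j))
        (RForest.not_glue_sAnc_zero_inr _ F G j)
  have hΦ : Function.Injective Φ := by
    rintro ⟨A, F, G⟩ ⟨A', F', G'⟩ hx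
    have hx' : RForest.glue (σ A) F.1 G.1 = RForest.glue (σ A') F'.1 G'.1 :=
      congrArg Subtype.val hx
    obtain rfl : A = A' := by
      ext i
      rw [hmem A F.1 G.1, hx', ← hmem A' F'.1 G'.1]
    obtain ⟨h1, h2⟩ := RForest.glue_injective _ hx'
    rw [Subtype.ext h1, Subtype.ext h2]
  refine le_trans (le_of_eq ?_) (Nat.card_le_card_of_injective Φ hΦ)
  rw [Nat.card_sigma]
  simp only [Nat.card_prod]
  have := Finset.sum_powerset_apply_card (fun k => fCount S k * fCount S (n - k))
    (x := (Finset.univ : Finset (Fin n)))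
  rw [Finset.powerset_univ, Finset.card_univ, Fintype.card_fin] at this
  simpa [fCount] using this.symm

end Counts

open Filter Topology Finset in
theorem exists_tendsto_of_not_begin_one {S : Set ((k : ℕ) × Pattern k)}
    (h : ∀ p ∈ S, ∀ h0 : 0 < p.1, (p.2 ⟨0, h0⟩ : ℕ) ≠ 0) :
    ∃ L : ℝ,
      Tendsto (fun n : ℕ => (fCount S n : ℝ) ^ ((n : ℝ)⁻¹) / (n : ℝ)) atTop (𝓝 L) ∧
      Tendsto (fun n : ℕ => (tCount S n : ℝ) ^ ((n : ℝ)⁻¹) / (n : ℝ)) atTop (𝓝 L) := by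
  by_cases hpos : ∀ p ∈ S, 0 < p.1
  swap
  · have hf : ∀ n, fCount S n = 0 := by
      push Not at hpos
      obtain ⟨⟨k, π⟩, hp, hk⟩ := hpos
      obtain rfl : k = 0 := Nat.le_zero.1 hk
      intro n
      have : IsEmpty {F : RForest n // AvoidsSet F S} :=
        ⟨fun F => F.2 _ hp ⟨fun i => i.elim0, fun i => i.elim0, fun i => i.elim0⟩⟩
      exact Nat.card_of_isEmpty
    have ht : ∀ n, tCount S n = 0 := fun n => Nat.le_zero.1 (hf n ▸ tCount_le_fCount S n)
    have hz : Tendsto (fun n : ℕ => (0 : ℝ) ^ ((n : ℝ)⁻¹) / (n : ℝ)) atTop (𝓝 0) := by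
      refine tendsto_const_nhds.congr' ?_
      filter_upwards [eventually_ge_atTop 1] with n hn
      rw [Real.zero_rpow (inv_ne_zero (by exact_mod_cast (by omega : n ≠ 0))), zero_div]
    exact ⟨0, by simpa only [hf, Nat.cast_zero] using hz, by simpa only [ht, Nat.cast_zero] using hz⟩
  set c : ℕ → ℝ := fun n => (fCount S n : ℝ) / n.factorial with hcdef
  have hfpos : ∀ n, 0 < fCount S n := by
    intro n
    induction n with
    | zero => exact one_le_fCount_zero hpos
    | succ n ih => exact ih.trans_le ((fCount_le_tCount_succ hpos h n).trans (tCount_le_fCount S _))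
  have hfpos' : ∀ n, (0 : ℝ) < fCount S n := fun n => by exact_mod_cast hfpos n
  have hc : ∀ n, 0 < c n := fun n => div_pos (hfpos' n) (by positivity)
  have h0 : 1 ≤ c 0 := by
    simp only [hcdef, Nat.factorial_zero, Nat.cast_one, div_one]
    exact_mod_cast one_le_fCount_zero hpos
  have hconv : ∀ n : ℕ, ∑ p ∈ antidiagonal n, c p.1 * c p.2 ≤ (n + 1) * c (n + 1) := by
    intro n
    have h1 : (∑ k ∈ range (n + 1), (n.choose k : ℝ) * (fCount S k * fCount S (n - k))) ≤
        fCount S (n + 1) := by exact_mod_cast sum_choose_mul_fCount_le h n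
    rw [Nat.sum_antidiagonal_eq_sum_range_succ_mk]
    have hn : (0 : ℝ) < n.factorial := by positivity
    have h2 : ((n : ℝ) + 1) * c (n + 1) = fCount S (n + 1) / n.factorial := by
      simp only [hcdef, Nat.factorial_succ]
      push_cast
      field_simp
    rw [h2, le_div_iff₀ hn, sum_mul]
    refine le_trans (le_of_eq (sum_congr rfl fun k hk => ?_)) h1
    rw [Nat.cast_choose ℝ (Nat.lt_succ_iff.1 (mem_range.1 hk))]
    simp only [hcdef]
    field_simp
  have hub : ∀ n : ℕ, c n ≤ Real.exp (n + 1) := by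
    intro n
    refine le_trans ?_ (Real.pow_div_factorial_le_exp (x := (n + 1 : ℝ)) (by positivity) n)
    simp only [hcdef]
    gcongr
    exact_mod_cast fCount_le_pow S n
  obtain ⟨l, hl⟩ := exists_tendsto_log_div_of_convolution_le h0 hc hconv hub
  have hlogc : Tendsto (fun n : ℕ => Real.log (c n) / n) atTop (𝓝 l) := by
    have h1 := hl.mul ((tendsto_const_nhds (x := (1 : ℝ))).add tendsto_one_div_atTop_nhds_zero_nat)
    rw [add_zero, mul_one] at h1
    refine h1.congr' ?_
    filter_upwards [eventually_ge_atTop 1] with n hn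
    have hn' : (0 : ℝ) < n := by exact_mod_cast hn
    field_simp
  refine ⟨Real.exp (l - 1), tendsto_root_div_of_tendsto_log_div (fun n _ => hfpos' n) hlogc,
    tendsto_root_div_of_tendsto_log_div (fun n hn => ?_) ?_⟩
  · obtain ⟨n, rfl⟩ : ∃ m, n = m + 1 := ⟨n - 1, by omega⟩
    exact_mod_cast (hfpos n).trans_le (fCount_le_tCount_succ hpos h n)
  · rw [← tendsto_add_atTop_iff_nat 1]
    have hlow := hl.sub ((tendsto_add_atTop_iff_nat 1).2 tendsto_log_natCast_div_atTop)
    rw [sub_zero] at hlow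
    refine tendsto_of_tendsto_of_tendsto_of_le_of_le hlow
      ((tendsto_add_atTop_iff_nat 1).2 hlogc) (fun n => ?_) fun n => ?_
    · have hle : (fCount S n : ℝ) ≤ tCount S (n + 1) := by
        exact_mod_cast fCount_le_tCount_succ hpos h n
      have hn : (0 : ℝ) < (n + 1 : ℕ) := by positivity
      have h1 : Real.log (c n) - Real.log ((n + 1 : ℕ) : ℝ) ≤
          Real.log ((tCount S (n + 1) : ℝ) / (n + 1).factorial) := by
        rw [← Real.log_div (hc n).ne' hn.ne']
        refine Real.log_le_log (div_pos (hc n) hn) ?_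
        simp only [hcdef, div_div]
        rw [Nat.factorial_succ, mul_comm (n + 1), Nat.cast_mul]
        gcongr
      calc Real.log (c n) / (n + 1) - Real.log ((n + 1 : ℕ) : ℝ) / ((n + 1 : ℕ) : ℝ)
          = (Real.log (c n) - Real.log ((n + 1 : ℕ) : ℝ)) / ((n + 1 : ℕ) : ℝ) := by
            rw [sub_div]; push_cast; rfl
        _ ≤ _ := by gcongr
    · have hpos' : (0 : ℝ) < tCount S (n + 1) := by
        exact_mod_cast (hfpos n).trans_le (fCount_le_tCount_succ hpos h n)
      have hle : (tCount S (n + 1) : ℝ) ≤ fCount S (n + 1) := by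
        exact_mod_cast tCount_le_fCount S (n + 1)
      simp only [hcdef]
      gcongr

/-- The forest Stanley–Wilf theorem for uncovered sets: if no pattern in `S` begins with
`1`, or no pattern in `S` begins with its largest element, then
`lim f_n(S)^{1/n}/n` and `lim t_n(S)^{1/n}/n` both exist (finite) and are equal. -/
theorem forest_stanley_wilf (S : Set ((k : ℕ) × Pattern k))
    (h : (∀ p ∈ S, ∀ h0 : 0 < p.1, (p.2 ⟨0, h0⟩ : ℕ) ≠ 0) ∨
         (∀ p ∈ S, ∀ h0 : 0 < p.1, (p.2 ⟨0, h0⟩ : ℕ) ≠ p.1 - 1)) :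
    ∃ L : ℝ,
      Filter.Tendsto (fun n : ℕ => (fCount S n : ℝ) ^ ((n : ℝ)⁻¹) / (n : ℝ))
        Filter.atTop (nhds L) ∧
      Filter.Tendsto (fun n : ℕ => (tCount S n : ℝ) ^ ((n : ℝ)⁻¹) / (n : ℝ))
        Filter.atTop (nhds L) := by
  rcases h with h | h
  · exact exists_tendsto_of_not_begin_one h
  · rw [← fCount_complPatterns S, ← tCount_complPatterns S]
    refine exists_tendsto_of_not_begin_one fun p hp h0 hz => h _ hp h0 ?_
    change ((p.2 ⟨0, h0⟩).rev : ℕ) = p.1 - 1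
    rw [Fin.val_rev, hz]
end
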